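/- arXiv:1605.01349 — 2 statements merged into one kernel-verified Lean document; each statement's English description precedes it below -/
import Mathlib

section
/- Let q ∈ ℂ with q ≠ 1, let m ≥ 1 and 0 ≤ ℓ ≤ m, let ζ₁,…,ζ_m be pairwise distinct complex numbers, and let f₁,…,f_ℓ : ℂ → ℂ be arbitrary functions. Then Σ_{σ∈S_m} [ ∏_{i=1}^ℓ f_i(ζ_{σ(i)}) · ∏_{1≤α<β≤m} (ζ_{σ(α)}−qζ_{σ(β)})/(ζ_{σ(α)}−ζ_{σ(β)}) ] = (q;q)_{m−ℓ}/(1−q)^{m−ℓ} · Σ_{J = {j₁<…<j_ℓ} ⊆ {1,…,m}} [ ∏_{j∈J, r∉J} (ζ_j−qζ_r)/(ζ_j−ζ_r) · Σ_{σ'∈S_ℓ} ∏_{i=1}^ℓ f_i(ζ_{j_{σ'(i)}}) · ∏_{1≤α<β≤ℓ} (ζ_{j_{σ'(α)}}−qζ_{j_{σ'(β)}})/(ζ_{j_{σ'(α)}}−ζ_{j_{σ'(β)}}) ], where (q;q)_r = ∏_{i=1}^{r}(1−q^i). -/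
open Finset

noncomputable section

/-- The finite q-Pochhammer symbol `(a;q)_m = ∏_{i=0}^{m-1} (1 - a q^i)`. -/
def qPoch {K : Type*} [CommRing K] (a q : K) (m : ℕ) : K :=
  ∏ i ∈ Finset.range m, (1 - a * q ^ i)

/-- The summand of the right-hand side of Lemma 8.1 corresponding to a subset
`J ⊆ {1,…,m}` of cardinality `ℓ`, enumerated in increasing order. -/
def innerTerm (q : ℂ) {m ℓ : ℕ} (ζ : Fin m → ℂ) (f : Fin ℓ → ℂ → ℂ)
    (J : Finset (Fin m)) (hc : J.card = ℓ) : ℂ :=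
  (∏ j ∈ J, ∏ r ∈ Jᶜ, (ζ j - q * ζ r) / (ζ j - ζ r)) *
    ∑ σ' : Equiv.Perm (Fin ℓ),
      (∏ i, f i (ζ (J.orderEmbOfFin hc (σ' i)))) *
      ∏ p ∈ (Finset.univ : Finset (Fin ℓ × Fin ℓ)).filter (fun p => p.1 < p.2),
        (ζ (J.orderEmbOfFin hc (σ' p.1)) - q * ζ (J.orderEmbOfFin hc (σ' p.2))) /
          (ζ (J.orderEmbOfFin hc (σ' p.1)) - ζ (J.orderEmbOfFin hc (σ' p.2)))

section

variable {K : Type*} [Field K] (q : K)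

lemma one_sub_mul_sum_prod_of_zero_notMem [DecidableEq K] {s : Finset K} (hs : (0 : K) ∉ s) :
    (1 - q) * ∑ z ∈ s, ∏ r ∈ s.erase z, (z - q * r) / (z - r) = 1 - q ^ #s := by
  set P : Polynomial K := ∏ r ∈ s, (Polynomial.X - Polynomial.C (q * r)) with hP
  have hmonic : P.Monic := Polynomial.monic_prod_X_sub_C (fun r => q * r) s
  have hdeg : P.degree = #s := by
    rw [Polynomial.degree_eq_natDegree hmonic.ne_zero, hP,
      Polynomial.natDegree_finsetProd_X_sub_C_eq_card]
  have heval (z : K) : P.eval z = ∏ r ∈ s, (z - q * r) := by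
    simp [hP, Polynomial.eval_prod]
  have h := Lagrange.leadingCoeff_eq_sum (s := insert 0 s) (v := id) (Set.injOn_id _) (P := P)
    (by rw [hdeg, card_insert_of_notMem hs]; norm_cast)
  rw [hmonic.leadingCoeff, sum_insert hs, erase_insert hs] at h
  have h0 : P.eval (id 0) / ∏ r ∈ s, (id 0 - id r) = q ^ #s := by
    rw [heval, ← prod_div_distrib, ← prod_const]
    refine prod_congr rfl fun r hr => ?_
    have : r ≠ 0 := fun h => hs (h ▸ hr)
    simp [this]
  rw [h0] at h
  rw [sub_eq_of_eq_add' h, mul_sum]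
  refine sum_congr rfl fun z hz => ?_
  have hz0 : z ≠ 0 := fun h => hs (h ▸ hz)
  rw [erase_insert_of_ne hz0.symm, prod_insert (by simp [hs]), heval,
    ← mul_prod_erase s _ hz, prod_div_distrib]
  simp only [id, sub_zero]
  rw [← one_sub_mul, mul_assoc, mul_left_comm, mul_div_mul_left _ _ hz0, mul_div_assoc]

lemma one_sub_mul_sum_prod [DecidableEq K] (s : Finset K) :
    (1 - q) * ∑ z ∈ s, ∏ r ∈ s.erase z, (z - q * r) / (z - r) = 1 - q ^ #s := by
  by_cases hs : (0 : K) ∈ s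
  · obtain ⟨t, ht, rfl⟩ : ∃ t, (0 : K) ∉ t ∧ insert 0 t = s :=
      ⟨s.erase 0, notMem_erase 0 s, insert_erase hs⟩
    have h0 : ∏ r ∈ t, (0 - q * r) / (0 - r) = q ^ #t := by
      rw [← prod_const]
      refine prod_congr rfl fun r hr => ?_
      have : r ≠ 0 := fun h => ht (h ▸ hr)
      simp [this]
    have hsum : ∑ z ∈ t, ∏ r ∈ (insert 0 t).erase z, (z - q * r) / (z - r) =
        ∑ z ∈ t, ∏ r ∈ t.erase z, (z - q * r) / (z - r) := by
      refine sum_congr rfl fun z hz => ?_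
      have hz0 : z ≠ 0 := fun h => ht (h ▸ hz)
      rw [erase_insert_of_ne hz0.symm, prod_insert (by simp [ht])]
      simp [hz0]
    rw [sum_insert ht, erase_insert ht, h0, hsum, mul_add,
      one_sub_mul_sum_prod_of_zero_notMem q ht, card_insert_of_notMem ht]
    ring
  · exact one_sub_mul_sum_prod_of_zero_notMem q hs

lemma one_sub_mul_sum_prod_ne {n : ℕ} {ζ : Fin n → K} (hζ : Function.Injective ζ) :
    (1 - q) * ∑ p, ∏ r ∈ univ.erase p, (ζ p - q * ζ r) / (ζ p - ζ r) = 1 - q ^ n := by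
  classical
  have h := one_sub_mul_sum_prod q (univ.map ⟨ζ, hζ⟩)
  rw [sum_map, card_map, card_fin] at h
  rw [← h]
  congr 1
  refine sum_congr rfl fun p _ => ?_
  rw [← map_erase, prod_map]
  rfl

end

lemma prod_filter_fst_lt_snd {M : Type*} [CommMonoid M] {n : ℕ} (g : Fin n → Fin n → M) :
    ∏ p ∈ (univ : Finset (Fin n × Fin n)).filter (fun p => p.1 < p.2), g p.1 p.2 =
      ∏ i, ∏ j, if i < j then g i j else 1 := by
  rw [prod_filter, Fintype.prod_prod_type]

lemma prod_swap_zero_succ {M : Type*} [CommMonoid M] {n : ℕ} (p : Fin (n + 1))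
    (g : Fin (n + 1) → M) :
    ∏ j : Fin n, g (Equiv.swap 0 p j.succ) = ∏ r ∈ univ.erase p, g r := by
  refine prod_nbij (fun j => Equiv.swap 0 p j.succ) ?_ ?_ ?_ fun _ _ => rfl
  · intro j _
    rw [mem_erase]
    refine ⟨fun h => ?_, mem_univ _⟩
    rw [Equiv.swap_apply_eq_iff, Equiv.swap_apply_right] at h
    exact Fin.succ_ne_zero j h
  · intro i _ j _ h
    exact Fin.succ_injective _ ((Equiv.swap 0 p).injective h)
  · intro r hr
    have hr' : Equiv.swap 0 p r ≠ 0 := by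
      rw [Ne, Equiv.swap_apply_eq_iff, Equiv.swap_apply_left]
      exact (mem_erase.mp hr).1
    obtain ⟨j, hj⟩ := Fin.exists_succ_eq.mpr hr'
    exact ⟨j, mem_coe.mpr (mem_univ _), by simp [hj]⟩

lemma symmetrization {K : Type*} [Field K] {q : K} (hq : q ≠ 1) (n : ℕ) {ζ : Fin n → K}
    (hζ : Function.Injective ζ) :
    ∑ σ : Equiv.Perm (Fin n),
        ∏ i, ∏ j, (if i < j then (ζ (σ i) - q * ζ (σ j)) / (ζ (σ i) - ζ (σ j)) else 1) =
      qPoch q q n / (1 - q) ^ n := by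
  induction n with
  | zero => simp [qPoch]
  | succ n ih =>
    have hq' : 1 - q ≠ 0 := sub_ne_zero.mpr hq.symm
    rw [← Equiv.Perm.decomposeFin.symm.sum_comp, Fintype.sum_prod_type]
    have key (p : Fin (n + 1)) (e : Equiv.Perm (Fin n)) :
        ∏ j : Fin n, (ζ p - q * ζ (Equiv.swap 0 p (e j).succ)) /
            (ζ p - ζ (Equiv.swap 0 p (e j).succ)) =
          ∏ r ∈ univ.erase p, (ζ p - q * ζ r) / (ζ p - ζ r) := by
      rw [Equiv.prod_comp e fun j => (ζ p - q * ζ (Equiv.swap 0 p j.succ)) /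
            (ζ p - ζ (Equiv.swap 0 p j.succ)),
        prod_swap_zero_succ p fun r => (ζ p - q * ζ r) / (ζ p - ζ r)]
    have hsum : ∑ p, ∏ r ∈ univ.erase p, (ζ p - q * ζ r) / (ζ p - ζ r) =
        (1 - q ^ (n + 1)) / (1 - q) := by
      rw [eq_div_iff hq', mul_comm, one_sub_mul_sum_prod_ne q hζ]
    have hrec : qPoch q q (n + 1) = qPoch q q n * (1 - q ^ (n + 1)) := by
      rw [qPoch, prod_range_succ, ← pow_succ', qPoch]
    rw [hrec, pow_succ (1 - q), mul_div_mul_comm, ← hsum, mul_sum]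
    refine sum_congr rfl fun p _ => ?_
    rw [← ih (ζ := fun i => ζ (Equiv.swap 0 p i.succ))
      (hζ.comp ((Equiv.swap 0 p).injective.comp (Fin.succ_injective n))), sum_mul]
    refine sum_congr rfl fun e _ => ?_
    rw [← key p e, mul_comm]
    simp [Fin.prod_univ_succ]

/-- The permutations of `Fin (ℓ + k)` that map the first `ℓ` indices onto `J` are obtained by
permuting the increasing enumerations of `J` and `Jᶜ`. -/
lemma sum_filter_map_castAdd_eq {M : Type*} [AddCommMonoid M] {ℓ k : ℕ}
    {J : Finset (Fin (ℓ + k))} (hJ : #J = ℓ) (hJ' : #Jᶜ = k)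
    (F : Equiv.Perm (Fin (ℓ + k)) → M) :
    ∑ σ with univ.map ((Fin.castAddEmb k).trans σ.toEmbedding) = J, F σ =
      ∑ σ' : Equiv.Perm (Fin ℓ), ∑ τ : Equiv.Perm (Fin k),
        F ((finSumFinEquiv.symm.trans (Equiv.Perm.sumCongr σ' τ)).trans
          (finSumEquivOfFinset hJ hJ')) := by
  rw [← Fintype.sum_prod_type']
  symm
  refine sum_nbij (fun x => (finSumFinEquiv.symm.trans (Equiv.Perm.sumCongr x.1 x.2)).trans
    (finSumEquivOfFinset hJ hJ')) ?_ ?_ ?_ fun _ _ => rfl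
  · rintro ⟨σ', τ⟩ -
    rw [mem_filter]
    refine ⟨mem_univ _, eq_of_subset_of_card_le (fun x hx => ?_) (by simp [hJ])⟩
    obtain ⟨i, -, rfl⟩ := mem_map.mp hx
    simp
  · rintro ⟨σ₁, τ₁⟩ - ⟨σ₂, τ₂⟩ - h
    refine Equiv.Perm.sumCongrHom_injective (Equiv.ext fun x => ?_)
    have := Equiv.congr_fun h (finSumFinEquiv x)
    simpa using this
  · intro σ hσ
    have hσ := (mem_filter.mp (mem_coe.mp hσ)).2
    set e := finSumEquivOfFinset hJ hJ' with he
    have hmaps : Set.MapsTo ((finSumFinEquiv.trans σ).trans e.symm)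
        (Set.range Sum.inl) (Set.range Sum.inl) := by
      rintro _ ⟨i, rfl⟩
      have hi : σ (Fin.castAdd k i) ∈ J := by
        rw [← hσ]
        exact mem_map_of_mem ((Fin.castAddEmb k).trans σ.toEmbedding) (mem_univ i)
      obtain ⟨j, hj⟩ : ∃ j, J.orderEmbOfFin hJ j = σ (Fin.castAdd k i) := by
        rwa [← mem_coe, ← J.range_orderEmbOfFin hJ] at hi
      refine ⟨j, ?_⟩
      simp [Equiv.eq_symm_apply, he, hj]
    obtain ⟨⟨σ', τ⟩, h⟩ := Equiv.Perm.mem_sumCongrHom_range_of_perm_mapsTo_inl hmaps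
    refine ⟨(σ', τ), mem_coe.mpr (mem_univ _), Equiv.ext fun x => ?_⟩
    have := Equiv.congr_fun h (finSumFinEquiv.symm x)
    simp only [Equiv.Perm.sumCongrHom_apply] at this
    simp [this]

lemma prod_prod_lt_add {M : Type*} [CommMonoid M] {ℓ k : ℕ}
    (g : Fin (ℓ + k) → Fin (ℓ + k) → M) :
    ∏ i, ∏ j, (if i < j then g i j else 1) =
      (∏ i : Fin ℓ, ∏ j : Fin k, g (Fin.castAdd k i) (Fin.natAdd ℓ j)) *
        (∏ i : Fin ℓ, ∏ j : Fin ℓ, if i < j then g (Fin.castAdd k i) (Fin.castAdd k j) else 1) *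
        ∏ i : Fin k, ∏ j : Fin k, if i < j then g (Fin.natAdd ℓ i) (Fin.natAdd ℓ j) else 1 := by
  have hlt (i : Fin ℓ) (j : Fin k) : Fin.castAdd k i < Fin.natAdd ℓ j := by
    rw [Fin.lt_def, Fin.val_castAdd, Fin.val_natAdd]; omega
  simp only [Fin.prod_univ_add, prod_mul_distrib, hlt, (hlt _ _).not_gt, if_true, if_false,
    prod_const_one, mul_one, (Fin.strictMono_castAdd k).lt_iff_lt,
    (Fin.strictMono_natAdd ℓ).lt_iff_lt]
  rw [mul_left_comm, mul_assoc]

lemma prod_orderEmbOfFin {M α : Type*} [CommMonoid M] [LinearOrder α] {n : ℕ} {s : Finset α}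
    (h : #s = n) (σ : Equiv.Perm (Fin n)) (g : α → M) :
    ∏ i, g (s.orderEmbOfFin h (σ i)) = ∏ x ∈ s, g x := by
  rw [Equiv.prod_comp σ fun i => g (s.orderEmbOfFin h i), ← prod_coe_sort s g]
  exact (s.orderIsoOfFin h).toEquiv.prod_comp fun x => g x

/-- Lemma 8.1: the partial symmetrization identity. -/
theorem partial_symmetrization (q : ℂ) (hq : q ≠ 1) (m ℓ : ℕ) (hm : 1 ≤ m) (hℓ : ℓ ≤ m)
    (ζ : Fin m → ℂ) (hζ : Function.Injective ζ) (f : Fin ℓ → ℂ → ℂ) :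
    ∑ σ : Equiv.Perm (Fin m),
        (∏ i : Fin ℓ, f i (ζ (σ (Fin.castLE hℓ i)))) *
        ∏ p ∈ (Finset.univ : Finset (Fin m × Fin m)).filter (fun p => p.1 < p.2),
          (ζ (σ p.1) - q * ζ (σ p.2)) / (ζ (σ p.1) - ζ (σ p.2))
      = qPoch q q (m - ℓ) / (1 - q) ^ (m - ℓ) *
          ∑ J ∈ (Finset.powersetCard ℓ (Finset.univ : Finset (Fin m))).attach,
            innerTerm q ζ f J.1 (Finset.mem_powersetCard.mp J.2).2 := by
  classical
  obtain ⟨k, rfl⟩ := Nat.exists_eq_add_of_le hℓ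
  have hmem (σ : Equiv.Perm (Fin (ℓ + k))) :
      univ.map ((Fin.castAddEmb k).trans σ.toEmbedding) ∈
        powersetCard ℓ (univ : Finset (Fin (ℓ + k))) := by
    simp [mem_powersetCard]
  rw [← sum_fiberwise_of_maps_to (t := (powersetCard ℓ (univ : Finset (Fin (ℓ + k)))).attach)
    (g := fun σ => ⟨_, hmem σ⟩) (fun _ _ => mem_attach _ _), mul_sum]
  refine sum_congr rfl fun J _ => ?_
  obtain ⟨J, hJmem⟩ := J
  have hJ : #J = ℓ := (mem_powersetCard.mp hJmem).2
  have hJ' : #Jᶜ = k := by rw [card_compl, hJ, Fintype.card_fin, Nat.add_sub_cancel_left]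
  simp only [Subtype.mk.injEq]
  rw [sum_filter_map_castAdd_eq hJ hJ', innerTerm, Nat.add_sub_cancel_left, mul_sum, mul_sum]
  refine sum_congr rfl fun σ' _ => ?_
  have hinj : Function.Injective fun i => ζ (Jᶜ.orderEmbOfFin hJ' i) :=
    hζ.comp (Jᶜ.orderEmbOfFin hJ').injective
  rw [← symmetrization hq k hinj, sum_mul]
  refine sum_congr rfl fun τ _ => ?_
  have hcross : ∏ j ∈ J, ∏ r ∈ Jᶜ, (ζ j - q * ζ r) / (ζ j - ζ r) =
      ∏ i, ∏ j, (ζ (J.orderEmbOfFin hJ (σ' i)) - q * ζ (Jᶜ.orderEmbOfFin hJ' (τ j))) /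
        (ζ (J.orderEmbOfFin hJ (σ' i)) - ζ (Jᶜ.orderEmbOfFin hJ' (τ j))) := by
    rw [← prod_orderEmbOfFin hJ σ']
    refine prod_congr rfl fun i _ => ?_
    rw [← prod_orderEmbOfFin hJ' τ]
  set ρ := (finSumFinEquiv.symm.trans (Equiv.Perm.sumCongr σ' τ)).trans
    (finSumEquivOfFinset hJ hJ') with hρ
  have hleft (i : Fin ℓ) : ρ (Fin.castAdd k i) = J.orderEmbOfFin hJ (σ' i) := by simp [hρ]
  have hright (i : Fin k) : ρ (Fin.natAdd ℓ i) = Jᶜ.orderEmbOfFin hJ' (τ i) := by simp [hρ]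
  have hcast (i : Fin ℓ) : Fin.castLE hℓ i = Fin.castAdd k i := rfl
  rw [prod_filter_fst_lt_snd fun a b => (ζ (ρ a) - q * ζ (ρ b)) / (ζ (ρ a) - ζ (ρ b)),
    prod_prod_lt_add, hcross,
    prod_filter_fst_lt_snd fun a b =>
      (ζ (J.orderEmbOfFin hJ (σ' a)) - q * ζ (J.orderEmbOfFin hJ (σ' b))) /
        (ζ (J.orderEmbOfFin hJ (σ' a)) - ζ (J.orderEmbOfFin hJ (σ' b)))]
  simp only [hleft, hright, hcast]
  ring

end
end

section
/- Let q ∈ (0,1), s ∈ (−1,0), n ≥ 1, and let u₁,…,u_n be pairwise distinct positive reals with u_i ≠ q·u_j for all i, j. Let 1 ≤ k ≤ n and θ ∈ Sign⁺_k. Then there exists δ₀ > 0 such that for all δ ∈ (0,δ₀) the q-correlation function formula holds: Σ_{ν ∈ Sign⁺_n} M_{u;ρ}(ν) · Q_{θ+1^k}(ν) = (−1)^k q^{k(k+1)/2}/((1−q)^k·k!) · (2πi)^{−k} ∮_{γ[ū]} ⋯ ∮_{γ[ū]} ∏_{1≤α≠β≤k} (w_α−w_β)/(w_α−qw_β) ·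 (−s)^{|θ|} · F^c_θ(w₁^{−1},…,w_k^{−1})/(w₁⋯w_k) · ∏_{i=1}^k ∏_{j=1}^n (1−q u_j w_i)/(1−u_j w_i) · dw₁⋯dw_k, where θ+1^k = (θ₁+1,…,θ_k+1), the series on the left converges absolutely, γ[ū] is the union of the positively oriented circles of radius δ centered at the points u₁^{−1},…,u_n^{−1}, and an integral ∮_{γ[ū]} means the sum of the circle integrals over these circles (the integrand, defined off the diagonals w_α = w_β, has removable singularities there). -/
open Finset

noncomputable section

/-- Signatures of length `n`: weakly decreasing tuples of nonnegative integers. -/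
abbrev Sign (n : ℕ) : Type :=
  {ν : Fin n → ℕ // ∀ i j : Fin n, i ≤ j → ν j ≤ ν i}

/-- The symmetric rational function `F_μ(u₁,…,u_M)` (symmetrization formula (4.20)). -/
def Ffun (q s : ℂ) {M : ℕ} (μ : Fin M → ℕ) (u : Fin M → ℂ) : ℂ :=
  ((1 - q) ^ M / ∏ i, (1 - s * u i)) *
    ∑ σ : Equiv.Perm (Fin M),
      (∏ p ∈ (Finset.univ : Finset (Fin M × Fin M)).filter (fun p => p.1 < p.2),
        (u (σ p.1) - q * u (σ p.2)) / (u (σ p.1) - u (σ p.2))) *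
      ∏ i, ((u (σ i) - s) / (1 - s * u (σ i))) ^ (μ i)

/-- Multiplicity of the value `k` among the parts of `lam`. -/
def mult {n : ℕ} (lam : Fin n → ℕ) (k : ℕ) : ℕ :=
  ((Finset.univ : Finset (Fin n)).filter (fun i => lam i = k)).card

/-- The conjugation constant `c(λ) = ∏_{k≥0} (s²;q)_{m_k}/(q;q)_{m_k}`. -/
def cconst (q s : ℂ) {n : ℕ} (lam : Fin n → ℕ) : ℂ :=
  ∏ᶠ k : ℕ, qPoch (s ^ 2) q (mult lam k) / qPoch q q (mult lam k)

/-- `F^c_λ = c(λ)·F_λ`. -/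
def Fc (q s : ℂ) {M : ℕ} (μ : Fin M → ℕ) (u : Fin M → ℂ) : ℂ :=
  cconst q s μ * Ffun q s μ u

/-- The symmetric rational function `G_ν(v₁,…,v_N)` (symmetrization formula (4.21)). -/
def Gfun (q s : ℂ) {n N : ℕ} (ν : Fin n → ℕ) (v : Fin N → ℂ) : ℂ :=
  if h : n - mult ν 0 ≤ N then
    (qPoch (s ^ 2) q n / (qPoch q q (N - (n - mult ν 0)) * qPoch (s ^ 2) q (mult ν 0))) *
      ((1 - q) ^ N / ∏ j, (1 - s * v j)) *
      ∑ σ : Equiv.Perm (Fin N),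
        (∏ p ∈ (Finset.univ : Finset (Fin N × Fin N)).filter (fun p => p.1 < p.2),
          (v (σ p.1) - q * v (σ p.2)) / (v (σ p.1) - v (σ p.2))) *
        (∏ j : Fin (n - mult ν 0),
          ((v (σ (Fin.castLE h j)) - s) / (1 - s * v (σ (Fin.castLE h j)))) ^
            (ν (Fin.castLE (Nat.sub_le n (mult ν 0)) j))) *
        (∏ i : Fin (n - mult ν 0), v (σ (Fin.castLE h i)) / (v (σ (Fin.castLE h i)) - s)) *
        (∏ j ∈ (Finset.univ : Finset (Fin N)).filter (fun j : Fin N => n - mult ν 0 ≤ (j : ℕ)),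
          (1 - s * q ^ (mult ν 0) * v (σ j)))
  else 0

/-- Iterated integral: `iterInt k ops f` applies the integration functional `ops i` to the
`i`-th variable (outermost first). -/
def iterInt : (k : ℕ) → (Fin k → ((ℂ → ℂ) → ℂ)) → ((Fin k → ℂ) → ℂ) → ℂ
  | 0, _, f => f Fin.elim0
  | k + 1, ops, f => ops 0 (fun z => iterInt k (fun i => ops i.succ) (fun u => f (Fin.cons z u)))

/-- The weight `M_{u;ρ}(ν) = 1_{ν_n ≥ 1}·(−s)^{|ν|−n}·F^c_{ν−1^n}(u)` of the stochastic higher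
spin six vertex model at time `n`, started from the empty configuration. -/
def Mwt (q s : ℂ) {n : ℕ} (u : Fin n → ℂ) (ν : Fin n → ℕ) : ℂ :=
  (if ∀ i, 1 ≤ ν i then (1 : ℂ) else 0) * (-s) ^ (∑ i, ν i - n) *
    Fc q s (fun i => ν i - 1) u

/-- The q-correlation observable
`Q_θ(ν) = Σ_{1≤i₁<…<i_k≤n : ν_{i_j}=θ_j} q^{i₁+…+i_k}` (indices are 1-based). -/
def Qobs {K : Type*} [Semiring K] (q : K) {n k : ℕ} (θ : Fin k → ℕ) (ν : Fin n → ℕ) : K :=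
  ∑ I ∈ (Finset.powersetCard k (Finset.univ : Finset (Fin n))).attach,
    if ∀ p : Fin k, ν (I.1.orderEmbOfFin (Finset.mem_powersetCard.mp I.2).2 p) = θ p
    then q ^ (∑ i ∈ I.1, ((i : ℕ) + 1)) else 0

section ShuffleAlgebra

set_option linter.unusedSectionVars false

variable {ι : Type*} [DecidableEq ι]

/-- The product of the weights `c b a` over `b ∈ B` and `a ∈ A`. -/
def cross (c : ι → ι → ℂ) (B A : Finset ι) : ℂ :=
  ∏ b ∈ B, ∏ a ∈ A, c b a

/-- Complex valued functions on finite subsets of `ι`, with the convolution product twisted by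
the weight `c`. -/
def ShuffleAlg (_c : ι → ι → ℂ) : Type _ := Finset ι → ℂ

namespace ShuffleAlg

variable {c : ι → ι → ℂ}

instance : AddCommGroup (ShuffleAlg c) := inferInstanceAs (AddCommGroup (Finset ι → ℂ))
instance : Module ℂ (ShuffleAlg c) := inferInstanceAs (Module ℂ (Finset ι → ℂ))
instance : CoeFun (ShuffleAlg c) (fun _ => Finset ι → ℂ) := ⟨fun F => F⟩
instance : Mul (ShuffleAlg c) :=
  ⟨fun F G => fun S => ∑ B ∈ S.powerset, F B * G (S \ B) * cross c B (S \ B)⟩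
instance : One (ShuffleAlg c) := ⟨fun S => if S = ∅ then 1 else 0⟩

@[ext] theorem ext {F G : ShuffleAlg c} (h : ∀ S, F S = G S) : F = G := funext h

theorem mul_apply (F G : ShuffleAlg c) (S : Finset ι) :
    (F * G) S = ∑ B ∈ S.powerset, F B * G (S \ B) * cross c B (S \ B) := rfl

theorem one_apply (S : Finset ι) : (1 : ShuffleAlg c) S = if S = ∅ then 1 else 0 := rfl

@[simp] theorem add_apply (F G : ShuffleAlg c) (S : Finset ι) : (F + G) S = F S + G S := rfl
@[simp] theorem sub_apply (F G : ShuffleAlg c) (S : Finset ι) : (F - G) S = F S - G S := rfl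
@[simp] theorem zero_apply (S : Finset ι) : (0 : ShuffleAlg c) S = 0 := rfl
@[simp] theorem smul_apply (z : ℂ) (F : ShuffleAlg c) (S : Finset ι) : (z • F) S = z * F S := rfl

theorem cross_union_left {A B C : Finset ι} (h : Disjoint A B) :
    cross c (A ∪ B) C = cross c A C * cross c B C := by
  rw [cross, prod_union h]; rfl

theorem cross_union_right {A B C : Finset ι} (h : Disjoint B C) :
    cross c A (B ∪ C) = cross c A B * cross c A C := by
  simp only [cross, prod_union h, prod_mul_distrib]

@[simp] theorem cross_empty_left (A : Finset ι) : cross c ∅ A = 1 := by simp [cross]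
@[simp] theorem cross_empty_right (A : Finset ι) : cross c A ∅ = 1 := by simp [cross]

protected theorem mul_assoc (F G H : ShuffleAlg c) : F * G * H = F * (G * H) := by
  ext S
  simp only [mul_apply, sum_mul, mul_sum]
  rw [sum_sigma', sum_sigma']
  refine sum_bij' (fun p _ => ⟨p.2, p.1 \ p.2⟩) (fun p _ => ⟨p.1 ∪ p.2, p.1⟩) ?_ ?_ ?_ ?_ ?_
  · rintro ⟨B, C⟩ h
    simp only [mem_sigma, mem_powerset] at h ⊢
    exact ⟨h.2.trans h.1, sdiff_subset_sdiff h.1 le_rfl⟩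
  · rintro ⟨C, D⟩ h
    simp only [mem_sigma, mem_powerset] at h ⊢
    exact ⟨union_subset h.1 (h.2.trans sdiff_subset), subset_union_left⟩
  · rintro ⟨B, C⟩ h
    simp only [mem_sigma, mem_powerset] at h
    simp [union_sdiff_of_subset h.2]
  · rintro ⟨C, D⟩ h
    simp only [mem_sigma, mem_powerset, subset_sdiff] at h
    simp [union_sdiff_cancel_left h.2.2.symm]
  · rintro ⟨B, C⟩ h
    simp only [mem_sigma, mem_powerset] at h
    obtain ⟨hB, hC⟩ := h
    have h1 : (S \ C) \ (B \ C) = S \ B := by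
      ext i; simp only [mem_sdiff]; constructor
      · rintro ⟨⟨h1, h2⟩, h3⟩; exact ⟨h1, fun h => h3 ⟨h, h2⟩⟩
      · rintro ⟨h1, h2⟩; exact ⟨⟨h1, fun h => h2 (hC h)⟩, fun h => h2 h.1⟩
    have h2 : S \ C = (B \ C) ∪ (S \ B) := by
      ext i; simp only [mem_sdiff, mem_union]; constructor
      · rintro ⟨h1, h2⟩; by_cases h : i ∈ B <;> simp [*]
      · rintro (h | h)
        · exact ⟨hB h.1, h.2⟩
        · exact ⟨h.1, fun h3 => h.2 (hC h3)⟩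
    have d1 : Disjoint (B \ C) (S \ B) :=
      disjoint_left.2 fun i h h' => (mem_sdiff.1 h').2 (mem_sdiff.1 h).1
    have e1 : cross c B (S \ B) = cross c C (S \ B) * cross c (B \ C) (S \ B) := by
      rw [← cross_union_left disjoint_sdiff, union_sdiff_of_subset hC]
    have e2 : cross c C (S \ C) = cross c C (B \ C) * cross c C (S \ B) := by
      rw [← cross_union_right d1, ← h2]
    simp only [h1, e1, e2]
    ring

instance : Ring (ShuffleAlg c) where
  __ := (inferInstance : AddCommGroup (ShuffleAlg c))
  mul_assoc := ShuffleAlg.mul_assoc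
  one_mul F := by
    ext S
    rw [mul_apply, sum_eq_single ∅]
    · simp [one_apply]
    · intro B _ h; simp [one_apply, h]
    · intro h; simp at h
  mul_one F := by
    ext S
    rw [mul_apply, sum_eq_single S]
    · simp [one_apply]
    · intro B hB h
      have : S \ B ≠ ∅ := fun h' =>
        h (Subset.antisymm (mem_powerset.1 hB) (sdiff_eq_empty_iff_subset.1 h'))
      simp [one_apply, this]
    · intro h; simp at h
  left_distrib F G H := by
    ext S; simp only [mul_apply, add_apply, mul_add, add_mul, sum_add_distrib]
  right_distrib F G H := by
    ext S; simp only [mul_apply, add_apply, add_mul, sum_add_distrib]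
  zero_mul F := by ext S; simp [mul_apply]
  mul_zero F := by ext S; simp [mul_apply]

instance : IsScalarTower ℂ (ShuffleAlg c) (ShuffleAlg c) :=
  ⟨fun z F G => by
    ext S; simp only [smul_eq_mul, mul_apply, smul_apply, mul_sum, mul_assoc]⟩

instance : SMulCommClass ℂ (ShuffleAlg c) (ShuffleAlg c) :=
  ⟨fun z F G => by
    ext S; simp only [smul_eq_mul, mul_apply, smul_apply, mul_sum]
    exact sum_congr rfl fun _ _ => by ring⟩

/-- Multiplication of `F S` by the product of the weights `x i` over `i ∈ S`. -/
def tw (x : ι → ℂ) (F : ShuffleAlg c) : ShuffleAlg c := fun S => (∏ i ∈ S, x i) * F S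

theorem tw_apply (x : ι → ℂ) (F : ShuffleAlg c) (S : Finset ι) :
    tw x F S = (∏ i ∈ S, x i) * F S := rfl

theorem tw_mul (x : ι → ℂ) (F G : ShuffleAlg c) : tw x (F * G) = tw x F * tw x G := by
  ext S
  simp only [tw_apply, mul_apply, mul_sum]
  refine sum_congr rfl fun B hB => ?_
  rw [← prod_sdiff (mem_powerset.1 hB)]
  ring

theorem tw_one (x : ι → ℂ) : tw x (1 : ShuffleAlg c) = 1 := by
  ext S
  by_cases h : S = ∅ <;> simp [tw_apply, one_apply, h]

theorem tw_smul (x : ι → ℂ) (z : ℂ) (F : ShuffleAlg c) : tw x (z • F) = z • tw x F := by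
  ext S; simp only [tw_apply, smul_apply]; ring

theorem tw_pow (x : ι → ℂ) (F : ShuffleAlg c) (m : ℕ) : tw x (F ^ m) = tw x F ^ m := by
  induction m with
  | zero => simp [tw_one]
  | succ m ih => rw [pow_succ, tw_mul, ih, pow_succ]

/-- The indicator function of the sets with `m` elements. -/
def ofCard (m : ℕ) : ShuffleAlg c := fun S => if #S = m then 1 else 0

theorem ofCard_apply (m : ℕ) (S : Finset ι) :
    (ofCard m : ShuffleAlg c) S = if #S = m then 1 else 0 := rfl

theorem ofCard_zero : (ofCard 0 : ShuffleAlg c) = 1 := by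
  ext S; simp [ofCard_apply, one_apply]

theorem ofCard_one_mul_apply (F : ShuffleAlg c) (S : Finset ι) :
    (ofCard 1 * F : ShuffleAlg c) S = ∑ i ∈ S, F (S.erase i) * ∏ b ∈ S.erase i, c i b := by
  have h : ∀ B ∈ S.powerset, (ofCard 1 : ShuffleAlg c) B * F (S \ B) * cross c B (S \ B) =
      if #B = 1 then F (S \ B) * cross c B (S \ B) else 0 := by
    intro B _; rw [ofCard_apply]; split_ifs <;> simp
  rw [mul_apply, sum_congr rfl h, ← sum_filter, ← powersetCard_eq_filter, powersetCard_one,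
    sum_map]
  refine sum_congr rfl fun i _ => ?_
  simp [cross, sdiff_singleton_eq_erase]

theorem mul_ofCard_one_apply (F : ShuffleAlg c) (S : Finset ι) :
    (F * ofCard 1 : ShuffleAlg c) S = ∑ i ∈ S, F (S.erase i) * ∏ b ∈ S.erase i, c b i := by
  have h : ∀ B ∈ S.powerset, F B * (ofCard 1 : ShuffleAlg c) (S \ B) * cross c B (S \ B) =
      if #(S \ B) = 1 then F B * cross c B (S \ B) else 0 := by
    intro B _; rw [ofCard_apply]; split_ifs <;> simp
  rw [mul_apply, sum_congr rfl h, ← sum_filter]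
  symm
  refine sum_bij (fun i _ => S.erase i) ?_ ?_ ?_ ?_
  · intro i hi
    simp [erase_subset, sdiff_erase hi]
  · intro i hi j hj h
    by_contra hne
    have : i ∈ S.erase j := mem_erase.2 ⟨hne, hi⟩
    rw [← h] at this; simp at this
  · intro B hB
    simp only [mem_filter, mem_powerset, card_eq_one] at hB
    obtain ⟨hB, i, hi⟩ := hB
    have hiS : i ∈ S \ B := by simp [hi]
    refine ⟨i, (mem_sdiff.1 hiS).1, ?_⟩
    rw [← sdiff_singleton_eq_erase, ← hi, Finset.sdiff_sdiff_eq_self hB]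
  · intro i hi
    rw [sdiff_erase hi]
    simp [cross]

end ShuffleAlg

end ShuffleAlgebra

section LagrangeIdentities

open Polynomial

/-- Lagrange interpolation at the nodes `0` and `v i`, for `i ∈ S`. -/
theorem eval_eq_interpolation_insert_zero {ι : Type*} [DecidableEq ι] (v : ι → ℂ)
    (hv : Function.Injective v) (h0 : ∀ i, v i ≠ 0) (S : Finset ι) (P : ℂ[X])
    (hP : P.degree ≤ #S) (z : ℂ) :
    P.eval z = P.eval 0 * ∏ b ∈ S, ((z - v b) / (0 - v b)) +
      ∑ i ∈ S, P.eval (v i) * (z / v i * ∏ b ∈ S.erase i, ((z - v b) / (v i - v b))) := by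
  let w : Option ι → ℂ := fun o => o.elim 0 v
  have hw : Function.Injective w := by
    rintro (_ | i) (_ | j) h
    · rfl
    · exact absurd h.symm (h0 j)
    · exact absurd h (h0 i)
    · exact congrArg some (hv h)
  have key := Lagrange.eq_interpolate (s := insertNone S) (v := w) (f := P) hw.injOn (by
    refine lt_of_le_of_lt hP ?_
    rw [card_insertNone]
    exact_mod_cast Nat.lt_succ_self _)
  have key2 := congrArg (eval z) key
  rw [key2, Lagrange.interpolate_apply, eval_finsetSum, sum_insertNone]
  congr 1
  · simp only [eval_mul, eval_C, Lagrange.basis, eval_prod, Lagrange.basisDivisor, eval_sub, eval_X]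
    congr 1
    have : (insertNone S).erase none = S.map Function.Embedding.some := by
      ext (_ | i) <;> simp
    rw [this, prod_map]
    refine prod_congr rfl fun b _ => ?_
    simp [w, div_eq_mul_inv, mul_comm]
  · refine sum_congr rfl fun i hi => ?_
    simp only [eval_mul, eval_C, Lagrange.basis, eval_prod, Lagrange.basisDivisor, eval_sub, eval_X]
    congr 1
    have : (insertNone S).erase (some i) = insertNone (S.erase i) := by
      ext (_ | j) <;> simp
    rw [this, prod_insertNone]
    congr 1
    · simp [w, div_eq_mul_inv, mul_comm]
    · refine prod_congr rfl fun b _ => ?_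
      simp [w, div_eq_mul_inv, mul_comm]

variable {ι : Type*} [DecidableEq ι]

/-- The two-body weight `(u i - q u j) / (u i - u j)`. -/
def qRatio (q : ℂ) (u : ι → ℂ) (i j : ι) : ℂ := (u i - q * u j) / (u i - u j)

theorem prod_div_mul_erase {S : Finset ι} {i : ι} (hi : i ∈ S) (f : ι → ℂ) :
    ∏ b ∈ S, f b = f i * ∏ b ∈ S.erase i, f b := (mul_prod_erase S f hi).symm

theorem sum_prod_qRatio_right (q : ℂ) (u : ι → ℂ) (hu : Function.Injective u)
    (h0 : ∀ i, u i ≠ 0) (S : Finset ι) (p y : ℂ) :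
    (1 - q) * y * ∑ i ∈ S, (∏ b ∈ S.erase i, (p * u b + y)) * ∏ b ∈ S.erase i, qRatio q u b i =
      ∏ b ∈ S, (p * u b + y) - ∏ b ∈ S, (p * u b + q * y) := by
  have gen : ∀ p : ℂ, p ≠ 0 →
      (1 - q) * y * ∑ i ∈ S, (∏ b ∈ S.erase i, (p * u b + y)) *
          ∏ b ∈ S.erase i, qRatio q u b i =
        ∏ b ∈ S, (p * u b + y) - ∏ b ∈ S, (p * u b + q * y) := by
    intro p hp
    have hv : Function.Injective fun i => p * u i := fun i j h => hu (mul_left_cancel₀ hp h)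
    have h1 : ∀ i, p * u i ≠ 0 := fun i => mul_ne_zero hp (h0 i)
    have key := eval_eq_interpolation_insert_zero (fun i => p * u i) hv h1 S
      (∏ b ∈ S, (C (p * u b) - C q * X)) (by
        refine (degree_prod_le _ _).trans ?_
        refine (sum_le_card_nsmul S _ 1 fun i _ => ?_).trans (by simp)
        compute_degree) (-y)
    simp only [eval_prod, eval_sub, eval_mul, eval_C, eval_X] at key
    have e1 : (∏ b ∈ S, (p * u b - q * 0)) * ∏ b ∈ S, ((-y - p * u b) / (0 - p * u b)) =
        ∏ b ∈ S, (p * u b + y) := by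
      rw [← prod_mul_distrib]
      refine prod_congr rfl fun b _ => ?_
      have := h1 b
      field_simp
      ring
    have e2 : ∀ i ∈ S, (∏ b ∈ S, (p * u b - q * (p * u i))) * (-y / (p * u i) *
        ∏ b ∈ S.erase i, ((-y - p * u b) / (p * u i - p * u b))) =
        -((1 - q) * y * ((∏ b ∈ S.erase i, (p * u b + y)) *
          ∏ b ∈ S.erase i, qRatio q u b i)) := by
      intro i hi
      rw [prod_div_mul_erase hi]
      have e3 : (∏ b ∈ S.erase i, (p * u b - q * (p * u i))) *
          ∏ b ∈ S.erase i, ((-y - p * u b) / (p * u i - p * u b)) =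
          (∏ b ∈ S.erase i, (p * u b + y)) * ∏ b ∈ S.erase i, qRatio q u b i := by
        rw [← prod_mul_distrib, ← prod_mul_distrib]
        refine prod_congr rfl fun b hb => ?_
        have h2 : u b - u i ≠ 0 := sub_ne_zero.2 fun h => (mem_erase.1 hb).1 (hu h)
        have h3 : p * u i - p * u b ≠ 0 := by
          rw [← mul_sub]; exact mul_ne_zero hp (by rw [← neg_sub]; exact neg_ne_zero.2 h2)
        rw [qRatio]
        field_simp
        rw [← neg_sub (u b) (u i)]
        field_simp
        ring
      have := h0 i
      rw [← e3]
      generalize ∏ b ∈ S.erase i, (p * u b - q * (p * u i)) = A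
      generalize ∏ b ∈ S.erase i, ((-y - p * u b) / (p * u i - p * u b)) = B
      field_simp
    rw [e1, sum_congr rfl e2, sum_neg_distrib, ← mul_sum] at key
    have e4 : ∏ b ∈ S, (p * u b + q * y) = ∏ b ∈ S, (p * u b - q * -y) :=
      prod_congr rfl fun b _ => by ring
    rw [e4, key]
    ring
  refine congrFun (Continuous.ext_on (dense_compl_singleton (0 : ℂ)) (f := fun p => (1 - q) * y *
    ∑ i ∈ S, (∏ b ∈ S.erase i, (p * u b + y)) * ∏ b ∈ S.erase i, qRatio q u b i)
    (g := fun p => ∏ b ∈ S, (p * u b + y) - ∏ b ∈ S, (p * u b + q * y))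
    (by fun_prop) (by fun_prop) fun p hp => gen p hp) p

theorem sum_prod_qRatio_left (q : ℂ) (u : ι → ℂ) (hu : Function.Injective u)
    (h0 : ∀ i, u i ≠ 0) (S : Finset ι) (p y : ℂ) :
    (1 - q) * y * ∑ i ∈ S, (∏ b ∈ S.erase i, (p * u b + y)) * ∏ b ∈ S.erase i, qRatio q u i b =
      ∏ b ∈ S, (q * p * u b + y) - ∏ b ∈ S, (q * p * u b + q * y) := by
  have gen : ∀ p : ℂ, p ≠ 0 →
      (1 - q) * y * ∑ i ∈ S, (∏ b ∈ S.erase i, (p * u b + y)) *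
          ∏ b ∈ S.erase i, qRatio q u i b =
        ∏ b ∈ S, (q * p * u b + y) - ∏ b ∈ S, (q * p * u b + q * y) := by
    intro p hp
    have hv : Function.Injective fun i => p * u i := fun i j h => hu (mul_left_cancel₀ hp h)
    have h1 : ∀ i, p * u i ≠ 0 := fun i => mul_ne_zero hp (h0 i)
    have key := eval_eq_interpolation_insert_zero (fun i => p * u i) hv h1 S
      (∏ b ∈ S, (C (q * (p * u b)) - X)) (by
        refine (degree_prod_le _ _).trans ?_
        refine (sum_le_card_nsmul S _ 1 fun i _ => ?_).trans (by simp)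
        compute_degree) (-y)
    simp only [eval_prod, eval_sub, eval_C, eval_X] at key
    have e1 : (∏ b ∈ S, (q * (p * u b) - 0)) * ∏ b ∈ S, ((-y - p * u b) / (0 - p * u b)) =
        ∏ b ∈ S, (q * p * u b + q * y) := by
      rw [← prod_mul_distrib]
      refine prod_congr rfl fun b _ => ?_
      have := h1 b
      field_simp
      ring
    have e2 : ∀ i ∈ S, (∏ b ∈ S, (q * (p * u b) - p * u i)) * (-y / (p * u i) *
        ∏ b ∈ S.erase i, ((-y - p * u b) / (p * u i - p * u b))) =
        (1 - q) * y * ((∏ b ∈ S.erase i, (p * u b + y)) *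
          ∏ b ∈ S.erase i, qRatio q u i b) := by
      intro i hi
      rw [prod_div_mul_erase hi]
      have e3 : (∏ b ∈ S.erase i, (q * (p * u b) - p * u i)) *
          ∏ b ∈ S.erase i, ((-y - p * u b) / (p * u i - p * u b)) =
          (∏ b ∈ S.erase i, (p * u b + y)) * ∏ b ∈ S.erase i, qRatio q u i b := by
        rw [← prod_mul_distrib, ← prod_mul_distrib]
        refine prod_congr rfl fun b hb => ?_
        have h2 : u i - u b ≠ 0 := sub_ne_zero.2 fun h => (mem_erase.1 hb).1 (hu h).symm
        have h3 : p * u i - p * u b ≠ 0 := by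
          rw [← mul_sub]; exact mul_ne_zero hp h2
        rw [qRatio]
        field_simp
        ring
      have := h0 i
      rw [← e3]
      generalize ∏ b ∈ S.erase i, (q * (p * u b) - p * u i) = A
      generalize ∏ b ∈ S.erase i, ((-y - p * u b) / (p * u i - p * u b)) = B
      field_simp
      ring
    rw [e1, sum_congr rfl e2, ← mul_sum] at key
    have e4 : ∏ b ∈ S, (q * p * u b + y) = ∏ b ∈ S, (q * (p * u b) - -y) :=
      prod_congr rfl fun b _ => by ring
    rw [e4, key]
    ring
  refine congrFun (Continuous.ext_on (dense_compl_singleton (0 : ℂ)) (f := fun p => (1 - q) * y *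
    ∑ i ∈ S, (∏ b ∈ S.erase i, (p * u b + y)) * ∏ b ∈ S.erase i, qRatio q u i b)
    (g := fun p => ∏ b ∈ S, (q * p * u b + y) - ∏ b ∈ S, (q * p * u b + q * y))
    (by fun_prop) (by fun_prop) fun p hp => gen p hp) p

end LagrangeIdentities

theorem qPoch_zero (a q : ℂ) : qPoch a q 0 = 1 := by simp [qPoch]

theorem qPoch_succ (a q : ℂ) (m : ℕ) : qPoch a q (m + 1) = qPoch a q m * (1 - a * q ^ m) :=
  prod_range_succ _ _

theorem qPoch_succ' (a q : ℂ) (m : ℕ) : qPoch a q (m + 1) = (1 - a) * qPoch (q * a) q m := by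
  rw [qPoch, prod_range_succ', mul_comm, qPoch]
  simp only [pow_zero, mul_one]
  congr 1
  exact prod_congr rfl fun i _ => by ring

theorem qPoch_add (a q : ℂ) (m r : ℕ) :
    qPoch a q (r + m) = qPoch a q r * qPoch (a * q ^ r) q m := by
  rw [qPoch, prod_range_add]
  congr 1
  exact prod_congr rfl fun i _ => by ring

theorem qPoch_self_succ (q : ℂ) (m : ℕ) :
    qPoch q q (m + 1) = qPoch q q m * (1 - q ^ (m + 1)) := by
  rw [qPoch_succ, pow_succ']

/-- The Gaussian binomial coefficient, zero unless `r ≤ m`. -/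
def qBinom (q : ℂ) (m r : ℕ) : ℂ :=
  if r ≤ m then qPoch q q m / (qPoch q q r * qPoch q q (m - r)) else 0

theorem qBinom_of_lt (q : ℂ) {m r : ℕ} (h : m < r) : qBinom q m r = 0 := if_neg (not_le.2 h)

theorem qPoch_self_ne_zero {q : ℂ} (hq : ∀ m : ℕ, q ^ (m + 1) ≠ 1) (m : ℕ) :
    qPoch q q m ≠ 0 := by
  refine prod_ne_zero_iff.2 fun i _ h => hq i ?_
  rw [pow_succ']
  exact (sub_eq_zero.1 h).symm

theorem qBinom_zero {q : ℂ} (hq : ∀ m : ℕ, q ^ (m + 1) ≠ 1) (m : ℕ) : qBinom q m 0 = 1 := by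
  simp [qBinom, qPoch_zero, qPoch_self_ne_zero hq m]

theorem qBinom_succ_succ {q : ℂ} (hq : ∀ m : ℕ, q ^ (m + 1) ≠ 1) (m r : ℕ) :
    qBinom q (m + 1) (r + 1) = q ^ (r + 1) * qBinom q m (r + 1) + qBinom q m r := by
  rcases lt_trichotomy m r with h | rfl | h
  · rw [qBinom_of_lt q h, qBinom_of_lt q (by omega), qBinom_of_lt q (by omega)]; ring
  · have h1 := qPoch_self_ne_zero hq m
    have h2 := qPoch_self_ne_zero hq (m + 1)
    rw [qBinom_of_lt q (Nat.lt_succ_self m)]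
    simp [qBinom, qPoch_zero, h1, h2]
  · obtain ⟨d, rfl⟩ := Nat.exists_eq_add_of_lt h
    have h1 := qPoch_self_ne_zero hq r
    have h2 := qPoch_self_ne_zero hq d
    have h3 : 1 - q ^ (r + 1) ≠ 0 := sub_ne_zero.2 (hq r).symm
    have h4 : 1 - q ^ (d + 1) ≠ 0 := sub_ne_zero.2 (hq d).symm
    have e1 : r + d + 1 - r = d + 1 := by omega
    have e2 : r + d + 1 + 1 - (r + 1) = d + 1 := by omega
    have e3 : r + d + 1 - (r + 1) = d := by omega
    rw [qBinom, qBinom, qBinom, if_pos (by omega), if_pos (by omega), if_pos (by omega), e1, e2,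
      e3, qPoch_self_succ q (r + d + 1), qPoch_self_succ q d, qPoch_self_succ q r]
    field_simp
    ring

namespace ShuffleAlg

set_option linter.unusedSectionVars false

variable {ι : Type*} [DecidableEq ι] {q : ℂ} {u : ι → ℂ}

/-- The set function `S ↦ ∏_{i ∈ S} (p u_i + y)`. -/
def affProd (q : ℂ) (u : ι → ℂ) (p y : ℂ) : ShuffleAlg (qRatio q u) :=
  fun S => ∏ i ∈ S, (p * u i + y)

/-- The set function `S ↦ (t;q)_{|S|}`. -/
def pochCard (q : ℂ) (u : ι → ℂ) (t : ℂ) : ShuffleAlg (qRatio q u) := fun S => qPoch t q #S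

/-- The set function `S ↦ (t;q)_{|S|}` times the Gaussian binomial coefficient `|S|` over `r`. -/
def pochBinom (q : ℂ) (u : ι → ℂ) (t : ℂ) (r : ℕ) : ShuffleAlg (qRatio q u) :=
  fun S => qPoch t q #S * qBinom q #S r

theorem affProd_mul_ofCard_one (hu : Function.Injective u) (h0 : ∀ i, u i ≠ 0)
    (p y : ℂ) :
    ((1 - q) * y) • (affProd q u p y * ofCard 1) = affProd q u p y - affProd q u p (q * y) := by
  ext S
  rw [smul_apply, mul_ofCard_one_apply]
  exact sum_prod_qRatio_right q u hu h0 S p y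

theorem ofCard_one_mul_affProd (hu : Function.Injective u) (h0 : ∀ i, u i ≠ 0)
    (p y : ℂ) :
    ((1 - q) * y) • (ofCard 1 * affProd q u p y) =
      affProd q u (q * p) y - affProd q u (q * p) (q * y) := by
  ext S
  rw [smul_apply, ofCard_one_mul_apply]
  exact sum_prod_qRatio_left q u hu h0 S p y

theorem ofCard_one_mul_affProd_eq (hu : Function.Injective u) (h0 : ∀ i, u i ≠ 0)
    (hq1 : q ≠ 1) (p y : ℂ) (hy : y ≠ 0) :
    ofCard 1 * affProd q u p y = affProd q u (q * p) y * ofCard 1 := by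
  have h : (1 - q) * y ≠ 0 := mul_ne_zero (sub_ne_zero.2 hq1.symm) hy
  refine smul_right_injective _ h ?_
  simp only
  rw [ofCard_one_mul_affProd hu h0, affProd_mul_ofCard_one hu h0]

theorem sum_prod_qRatio (hu : Function.Injective u) (h0 : ∀ i, u i ≠ 0)
    (S : Finset ι) :
    (1 - q) * ∑ i ∈ S, ∏ b ∈ S.erase i, qRatio q u i b = 1 - q ^ #S := by
  have := sum_prod_qRatio_left q u hu h0 S 0 1
  simpa using this

theorem ofCard_one_mul_pochCard (hu : Function.Injective u) (h0 : ∀ i, u i ≠ 0)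
    (t : ℂ) :
    (t * (1 - q)) • (ofCard 1 * pochCard q u (q * t)) =
      pochCard q u (q * t) - pochCard q u t := by
  ext S
  rw [smul_apply, ofCard_one_mul_apply, sub_apply]
  have h1 : ∀ i ∈ S, pochCard q u (q * t) (S.erase i) * ∏ b ∈ S.erase i, qRatio q u i b =
      qPoch (q * t) q (#S - 1) * ∏ b ∈ S.erase i, qRatio q u i b := by
    intro i hi
    rw [pochCard, card_erase_of_mem hi]
  rw [sum_congr rfl h1, ← mul_sum]
  have h2 := sum_prod_qRatio (q := q) hu h0 S
  simp only [pochCard]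
  rcases Nat.eq_zero_or_pos #S with h | h
  · rw [h] at h2 ⊢
    rw [card_eq_zero.1 h]
    simp [qPoch_zero]
  · obtain ⟨m, hm⟩ := Nat.exists_eq_add_of_lt h
    rw [zero_add] at hm
    rw [hm] at h2 ⊢
    rw [Nat.add_sub_cancel, qPoch_succ' t, qPoch_succ]
    linear_combination t * qPoch (q * t) q m * h2

theorem affProd_mul_pochCard_step (hu : Function.Injective u) (h0 : ∀ i, u i ≠ 0)
    (p t : ℂ) :
    affProd q u p t * pochCard q u t = affProd q u p (q * t) * pochCard q u (q * t) := by
  have h1 := ofCard_one_mul_pochCard (q := q) hu h0 t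
  have h2 := affProd_mul_ofCard_one (q := q) hu h0 p t
  have h3 : pochCard q u t =
      pochCard q u (q * t) - (t * (1 - q)) • (ofCard 1 * pochCard q u (q * t)) := by
    rw [h1]; abel
  rw [h3, mul_sub, mul_smul_comm, ← mul_assoc, ← smul_mul_assoc, mul_comm t, h2, sub_mul]
  abel

theorem affProd_mul_pochCard (hu : Function.Injective u) (h0 : ∀ i, u i ≠ 0)
    (hq : ‖q‖ < 1) (p t : ℂ) :
    affProd q u p t * pochCard q u t = affProd q u p 1 := by
  ext S
  have hc : Continuous fun t : ℂ => (affProd q u p t * pochCard q u t) S := by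
    simp only [mul_apply, affProd, pochCard, qPoch]
    fun_prop
  have hlim : ∀ t : ℂ, (affProd q u p t * pochCard q u t) S =
      (affProd q u p 0 * pochCard q u 0) S := by
    intro t
    have h1 : ∀ m : ℕ, (affProd q u p (q ^ m * t) * pochCard q u (q ^ m * t)) S =
        (affProd q u p t * pochCard q u t) S := by
      intro m
      induction m with
      | zero => simp
      | succ m ih => rw [← ih, pow_succ', mul_assoc, ← affProd_mul_pochCard_step hu h0]
    have h2 : Filter.Tendsto (fun m : ℕ => q ^ m * t) Filter.atTop (nhds 0) := by
      simpa using (tendsto_pow_atTop_nhds_zero_of_norm_lt_one hq).mul_const t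
    have h3 := (hc.tendsto 0).comp h2
    simp only [Function.comp_def, h1] at h3
    exact tendsto_nhds_unique tendsto_const_nhds h3
  rw [hlim t, ← hlim 1]
  have : pochCard q u 1 = 1 := by
    ext T
    simp only [pochCard, one_apply]
    split_ifs with h
    · simp [h, qPoch_zero]
    · obtain ⟨m, hm⟩ := Nat.exists_eq_succ_of_ne_zero (fun h' => h (card_eq_zero.1 h'))
      rw [hm, Nat.succ_eq_add_one, qPoch_succ']
      simp
  rw [this, mul_one]

theorem ofCard_one_mul_ofCard (hu : Function.Injective u) (h0 : ∀ i, u i ≠ 0)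
    (m : ℕ) :
    (1 - q) • (ofCard 1 * ofCard m : ShuffleAlg (qRatio q u)) =
      (1 - q ^ (m + 1)) • ofCard (m + 1) := by
  ext S
  rw [smul_apply, smul_apply, ofCard_one_mul_apply]
  have h1 : ∀ i ∈ S, (ofCard m : ShuffleAlg (qRatio q u)) (S.erase i) *
      ∏ b ∈ S.erase i, qRatio q u i b =
      (if #S = m + 1 then 1 else 0) * ∏ b ∈ S.erase i, qRatio q u i b := by
    intro i hi
    have := card_pos.2 ⟨i, hi⟩
    rw [ofCard_apply, card_erase_of_mem hi]
    congr 2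
    exact propext ⟨fun h => by omega, fun h => by omega⟩
  rw [sum_congr rfl h1, ← mul_sum, ofCard_apply]
  have h2 := sum_prod_qRatio (q := q) hu h0 S
  split_ifs with h
  · rw [h] at h2; linear_combination h2
  · ring

theorem ofCard_one_pow (hu : Function.Injective u) (h0 : ∀ i, u i ≠ 0)
    (hq1 : q ≠ 1) (m : ℕ) :
    (ofCard 1 : ShuffleAlg (qRatio q u)) ^ m = (qPoch q q m / (1 - q) ^ m) • ofCard m := by
  have hne : 1 - q ≠ 0 := sub_ne_zero.2 hq1.symm
  induction m with
  | zero => simp [qPoch_zero, ofCard_zero]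
  | succ m ih =>
    have h := ofCard_one_mul_ofCard (q := q) hu h0 m
    have h' : (ofCard 1 * ofCard m : ShuffleAlg (qRatio q u)) =
        ((1 - q)⁻¹ * (1 - q ^ (m + 1))) • ofCard (m + 1) := by
      rw [mul_smul, ← h, smul_smul, inv_mul_cancel₀ hne, one_smul]
    rw [pow_succ', ih, mul_smul_comm, h', smul_smul, qPoch_self_succ]
    congr 1
    field_simp
    ring

theorem ofCard_mul_ofCard (hu : Function.Injective u) (h0 : ∀ i, u i ≠ 0)
    (hq : ∀ m : ℕ, q ^ (m + 1) ≠ 1) (m r : ℕ) :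
    (ofCard m * ofCard r : ShuffleAlg (qRatio q u)) =
      (qPoch q q (m + r) / (qPoch q q m * qPoch q q r)) • ofCard (m + r) := by
  have hq1 : q ≠ 1 := by simpa using hq 0
  have hne : 1 - q ≠ 0 := sub_ne_zero.2 hq1.symm
  have key := pow_add (ofCard 1 : ShuffleAlg (qRatio q u)) m r
  rw [ofCard_one_pow hu h0 hq1, ofCard_one_pow hu h0 hq1, ofCard_one_pow hu h0 hq1,
    smul_mul_smul_comm] at key
  have h1 := qPoch_self_ne_zero hq m
  have h2 := qPoch_self_ne_zero hq r
  have h3 : qPoch q q m / (1 - q) ^ m * (qPoch q q r / (1 - q) ^ r) ≠ 0 := by positivity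
  refine smul_right_injective _ h3 ?_
  simp only
  rw [← key, smul_smul]
  congr 1
  field_simp
  ring

theorem ofCard_mul_affProd (hu : Function.Injective u) (h0 : ∀ i, u i ≠ 0)
    (hq : ∀ m : ℕ, q ^ (m + 1) ≠ 1) (p y : ℂ) (hy : y ≠ 0) (r : ℕ) :
    ofCard r * affProd q u p y = affProd q u (q ^ r * p) y * ofCard r := by
  have hq1 : q ≠ 1 := by simpa using hq 0
  have hne : 1 - q ≠ 0 := sub_ne_zero.2 hq1.symm
  have hpow : ∀ p : ℂ, (ofCard 1 : ShuffleAlg (qRatio q u)) ^ r * affProd q u p y =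
      affProd q u (q ^ r * p) y * ofCard 1 ^ r := by
    induction r with
    | zero => intro p; simp
    | succ r ih =>
      intro p
      rw [pow_succ, mul_assoc, ofCard_one_mul_affProd_eq hu h0 hq1 p y hy, ← mul_assoc, ih,
        mul_assoc, ← pow_succ, pow_succ q, mul_assoc]
  have h := hpow p
  rw [ofCard_one_pow hu h0 hq1, smul_mul_assoc, mul_smul_comm] at h
  have h3 : qPoch q q r / (1 - q) ^ r ≠ 0 :=
    div_ne_zero (qPoch_self_ne_zero hq r) (pow_ne_zero _ hne)
  exact smul_right_injective _ h3 h

theorem pochCard_mul_ofCard_apply (hu : Function.Injective u) (h0 : ∀ i, u i ≠ 0)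
    (hq : ∀ m : ℕ, q ^ (m + 1) ≠ 1) (t : ℂ) (r : ℕ)
    (S : Finset ι) :
    (pochCard q u t * ofCard r : ShuffleAlg (qRatio q u)) S = qPoch t q (#S - r) * qBinom q #S r := by
  rw [mul_apply]
  by_cases hr : r ≤ #S
  · have h1 : ∀ B ∈ S.powerset, pochCard q u t B * (ofCard r : ShuffleAlg (qRatio q u)) (S \ B) *
        cross (qRatio q u) B (S \ B) = qPoch t q (#S - r) *
        ((ofCard (#S - r) : ShuffleAlg (qRatio q u)) B *
          (ofCard r : ShuffleAlg (qRatio q u)) (S \ B) * cross (qRatio q u) B (S \ B)) := by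
      intro B hB
      have hc := card_sdiff_add_card_eq_card (mem_powerset.1 hB)
      simp only [ofCard_apply, pochCard]
      by_cases h2 : #(S \ B) = r
      · have h3 : #B = #S - r := by omega
        simp [h2, h3]
      · simp [h2]
    rw [sum_congr rfl h1, ← mul_sum, ← mul_apply, ofCard_mul_ofCard hu h0 hq, smul_apply,
      ofCard_apply, if_pos (by omega), qBinom, if_pos hr, Nat.sub_add_cancel hr, mul_one,
      mul_comm (qPoch q q r)]
  · rw [qBinom_of_lt q (not_le.1 hr), mul_zero]
    refine sum_eq_zero fun B hB => ?_
    have hc := card_sdiff_add_card_eq_card (mem_powerset.1 hB)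
    rw [ofCard_apply, if_neg (by omega)]
    simp

/-- The exchange relation that drives the computation of the correlation functions. -/
theorem tw_affProd_mul (hu : Function.Injective u) (h0 : ∀ i, u i ≠ 0)
    (hq : ∀ m : ℕ, q ^ (m + 1) ≠ 1) (hqn : ‖q‖ < 1) (p t : ℂ) (r : ℕ) :
    tw (fun _ => q ^ r) (affProd q u p t) * pochBinom q u t r =
      qPoch t q r • (ofCard r * affProd q u p 1) := by
  have h1 : pochBinom q u t r =
      qPoch t q r • (pochCard q u (q ^ r * t) * ofCard r) := by
    ext S
    rw [smul_apply, pochCard_mul_ofCard_apply hu h0 hq, pochBinom]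
    by_cases hr : r ≤ #S
    · obtain ⟨d, hd⟩ := Nat.exists_eq_add_of_le hr
      rw [hd, qPoch_add, Nat.add_sub_cancel_left, mul_comm (q ^ r) t]
      ring
    · rw [qBinom_of_lt q (not_le.1 hr)]; ring
  have h2 : tw (fun _ => q ^ r) (affProd q u p t) = affProd q u (q ^ r * p) (q ^ r * t) := by
    ext S
    simp only [tw_apply, affProd, ← prod_mul_distrib]
    exact prod_congr rfl fun i _ => by ring
  rw [h1, h2, mul_smul_comm, ← mul_assoc, affProd_mul_pochCard hu h0 hqn,
    ofCard_mul_affProd hu h0 hq p 1 one_ne_zero]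

end ShuffleAlg

theorem triangle_add (K r : ℕ) :
    (K + r) * (K + r + 1) / 2 = K * (K + 1) / 2 + (r * (r + 1) / 2 + K * r) := by
  obtain ⟨a, ha⟩ := Nat.even_mul_succ_self K
  obtain ⟨b, hb⟩ := Nat.even_mul_succ_self r
  have h : (K + r) * (K + r + 1) = 2 * (a + (b + K * r)) := by
    linear_combination ha + hb
  rw [h, ha, hb]
  omega

namespace ShuffleAlg

set_option linter.unusedSectionVars false

variable {ι : Type*} [DecidableEq ι]

theorem tw_const_ofCard {c : ι → ι → ℂ} (z : ℂ) (m : ℕ) :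
    tw (fun _ => z) (ofCard m : ShuffleAlg c) = z ^ m • ofCard m := by
  ext S
  rw [tw_apply, smul_apply, ofCard_apply, prod_const]
  split_ifs with h
  · rw [h]
  · simp

/-- The product, over levels `j < L` in decreasing order, of the indicators of sets with `m j`
elements, weighted by the `j`-th powers of the `x i`. -/
def levelWord (c : ι → ι → ℂ) (x : ι → ℂ) (m : ℕ → ℕ) : ℕ → ShuffleAlg c
  | 0 => 1
  | L + 1 => tw (fun i => x i ^ L) (ofCard (m L)) * levelWord c x m L

theorem levelWord_congr (c : ι → ι → ℂ) (x : ι → ℂ) {m m' : ℕ → ℕ} (L : ℕ)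
    (h : ∀ j < L, m j = m' j) : levelWord c x m L = levelWord c x m' L := by
  induction L with
  | zero => rfl
  | succ L ih =>
    rw [levelWord, levelWord, h L (Nat.lt_succ_self L), ih fun j hj => h j (by omega)]

variable (q t : ℂ) (u x : ι → ℂ) (r : ℕ → ℕ)

/-- The coefficient of a level `j` containing `m` particles, `r j` of which are marked. -/
def levelCoef (j m : ℕ) : ℂ :=
  qPoch t q m * qBinom q m (r j) * q ^ (r j * (r j + 1) / 2 + (∑ i ∈ range j, r i) * m)

/-- The product over levels `j < L`, in decreasing order, of the sums over the particles at level
`j`. -/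
def levelProd : ℕ → ShuffleAlg (qRatio q u)
  | 0 => 1
  | L + 1 => tw (fun i => x i ^ L) (tw (fun _ => q ^ (∑ i ∈ range L, r i))
      (q ^ (r L * (r L + 1) / 2) • pochBinom q u t (r L))) * levelProd L

/-- The product over levels `j < L`, in decreasing order, of the contributions of sets with `r j`
elements. -/
def markedProd : ℕ → ShuffleAlg (qRatio q u)
  | 0 => 1
  | L + 1 => tw (fun i => x i ^ L) (qPoch t q (r L) • ofCard (r L)) * markedProd L

variable {q t u x r}

theorem markedProd_eq (L : ℕ) :
    markedProd q t u x r L = (∏ j ∈ range L, qPoch t q (r j)) • levelWord (qRatio q u) x r L := by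
  induction L with
  | zero => simp [markedProd, levelWord]
  | succ L ih =>
    rw [markedProd, levelWord, ih, tw_smul, smul_mul_smul_comm, prod_range_succ, mul_comm]

theorem tw_affProd_mul_levelProd (hu : Function.Injective u) (h0 : ∀ i, u i ≠ 0)
    (hq : ∀ m : ℕ, q ^ (m + 1) ≠ 1) (hqn : ‖q‖ < 1) (p : ℂ)
    (hx : ∀ i, x i * (p * u i + 1) = p * u i + t) (L : ℕ) :
    tw (fun i => x i ^ L) (tw (fun _ => q ^ (∑ i ∈ range L, r i)) (affProd q u p 1)) *
        levelProd q t u x r L =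
      q ^ ((∑ i ∈ range L, r i) * (∑ i ∈ range L, r i + 1) / 2) •
        (markedProd q t u x r L * affProd q u p 1) := by
  induction L with
  | zero =>
    have h1 : ∀ F : ShuffleAlg (qRatio q u), tw (fun _ => 1) F = F := by
      intro F; ext S; simp [tw_apply]
    simp [levelProd, markedProd, h1]
  | succ L ih =>
    set K := ∑ i ∈ range L, r i with hK
    have e0 : tw x (affProd q u p 1) = affProd q u p t := by
      ext S
      simp only [tw_apply, affProd, ← prod_mul_distrib, hx]
    have e1 : tw (fun i => x i ^ (L + 1)) (tw (fun _ => q ^ (K + r L)) (affProd q u p 1)) =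
        tw (fun i => x i ^ L) (tw (fun _ => q ^ K) (tw (fun _ => q ^ r L)
          (affProd q u p t))) := by
      rw [← e0]
      ext S
      simp only [tw_apply, pow_succ, pow_add, prod_mul_distrib]
      ring
    rw [sum_range_succ, ← hK, e1, levelProd, ← hK, ← mul_assoc, ← tw_mul, ← tw_mul, mul_smul_comm,
      tw_affProd_mul hu h0 hq hqn, tw_smul, tw_smul, tw_smul, tw_smul, tw_mul, tw_mul,
      tw_const_ofCard, tw_smul, smul_mul_assoc, smul_mul_assoc, smul_mul_assoc, smul_mul_assoc,
      mul_assoc, ih, mul_smul_comm, markedProd, tw_smul, smul_mul_assoc, smul_mul_assoc, mul_assoc,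
      smul_smul, smul_smul, smul_smul, smul_smul, triangle_add]
    congr 1
    rw [pow_add, pow_add, pow_mul]
    ring

theorem markedProd_eq_of_le {L L' : ℕ} (hL : L ≤ L') (hr : ∀ j, L ≤ j → r j = 0) :
    markedProd q t u x r L' = markedProd q t u x r L := by
  induction L', hL using Nat.le_induction with
  | base => rfl
  | succ M hM ih =>
    rw [markedProd, hr M hM, ih, ofCard_zero, qPoch_zero, one_smul, tw_one, one_mul]

theorem tendsto_levelProd (hu : Function.Injective u) (h0 : ∀ i, u i ≠ 0)
    (hq : ∀ m : ℕ, q ^ (m + 1) ≠ 1) (hqn : ‖q‖ < 1) (p : ℂ)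
    (hx : ∀ i, x i * (p * u i + 1) = p * u i + t) (hx1 : ∀ i, ‖x i‖ < 1) {L₀ k : ℕ}
    (hr : ∀ j, L₀ ≤ j → r j = 0) (hk : ∑ i ∈ range L₀, r i = k) (S : Finset ι) :
    Filter.Tendsto (fun L => levelProd q t u x r L S) Filter.atTop
      (nhds (q ^ (k * (k + 1) / 2) * (markedProd q t u x r L₀ * affProd q u p 1 :
        ShuffleAlg (qRatio q u)) S)) := by
  have hxL : ∀ S : Finset ι, S ≠ ∅ →
      Filter.Tendsto (fun L : ℕ => ∏ i ∈ S, x i ^ L) Filter.atTop (nhds 0) := by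
    intro S hS
    obtain ⟨i, hi⟩ := nonempty_iff_ne_empty.2 hS
    have h1 : ‖∏ i ∈ S, x i‖ < 1 := by
      rw [norm_prod, ← mul_prod_erase _ _ hi]
      exact mul_lt_one_of_nonneg_of_lt_one_left (norm_nonneg _) (hx1 i)
        (prod_le_one (fun _ _ => norm_nonneg _) fun j _ => (hx1 j).le)
    simpa only [prod_pow] using tendsto_pow_atTop_nhds_zero_of_norm_lt_one h1
  induction S using Finset.strongInduction with
  | H S ih =>
    have key : ∀ L, L₀ ≤ L → levelProd q t u x r L S =
        q ^ (k * (k + 1) / 2) * (markedProd q t u x r L₀ * affProd q u p 1 :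
          ShuffleAlg (qRatio q u)) S -
        ∑ B ∈ S.powerset.erase ∅, ((∏ i ∈ B, x i ^ L) *
          ((∏ i ∈ B, q ^ k) * affProd q u p 1 B)) * levelProd q t u x r L (S \ B) *
            cross (qRatio q u) B (S \ B) := by
      intro L hL
      have hKL : ∑ i ∈ range L, r i = k := by
        rw [← hk]
        refine (sum_subset (range_mono hL) fun j _ hj => hr j ?_).symm
        simpa using hj
      have h := tw_affProd_mul_levelProd (r := r) hu h0 hq hqn p hx L
      rw [hKL, markedProd_eq_of_le hL hr] at h
      have h' := congrFun h S
      rw [mul_apply, ← add_sum_erase _ _ (empty_mem_powerset S)] at h'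
      simp only [tw_apply] at h'
      rw [eq_sub_iff_add_eq, ← smul_apply]
      refine Eq.trans ?_ h'
      simp [affProd]
    have hlim : Filter.Tendsto (fun L : ℕ => q ^ (k * (k + 1) / 2) *
        (markedProd q t u x r L₀ * affProd q u p 1 : ShuffleAlg (qRatio q u)) S -
        ∑ B ∈ S.powerset.erase ∅, ((∏ i ∈ B, x i ^ L) *
          ((∏ i ∈ B, q ^ k) * affProd q u p 1 B)) * levelProd q t u x r L (S \ B) *
            cross (qRatio q u) B (S \ B)) Filter.atTop
        (nhds (q ^ (k * (k + 1) / 2) *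
          (markedProd q t u x r L₀ * affProd q u p 1 : ShuffleAlg (qRatio q u)) S - 0)) := by
      refine tendsto_const_nhds.sub ?_
      rw [show (0 : ℂ) = ∑ B ∈ S.powerset.erase ∅, (0 : ℂ) by simp]
      refine tendsto_finsetSum _ fun B hB => ?_
      obtain ⟨hB0, hBS⟩ := mem_erase.1 hB
      have hss : S \ B ⊂ S :=
        sdiff_ssubset (mem_powerset.1 hBS) (nonempty_iff_ne_empty.2 hB0)
      have := (((hxL B hB0).mul_const ((∏ i ∈ B, q ^ k) * affProd q u p 1 B)).mul
        (ih _ hss)).mul_const (cross (qRatio q u) B (S \ B))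
      simpa using this
    rw [sub_zero] at hlim
    refine hlim.congr' ?_
    filter_upwards [Filter.eventually_ge_atTop L₀] with L hL using (key L hL).symm

theorem levelProd_apply (L : ℕ) (S : Finset ι) :
    levelProd q t u x r L S = ∑ m ∈ piAntidiag (range L) #S,
      (∏ j ∈ range L, levelCoef q t r j (m j)) * levelWord (qRatio q u) x m L S := by
  induction L generalizing S with
  | zero =>
    rw [range_zero, levelProd, one_apply]
    by_cases hS : S = ∅
    · simp [hS, levelWord, one_apply]
    · rw [if_neg hS, piAntidiag_empty_of_ne_zero (by simpa using hS)]
      simp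
  | succ L ih =>
    have hL : L ∉ range L := by simp
    have hA : ∀ B ∈ S.powerset, tw (fun i => x i ^ L) (tw (fun _ => q ^ (∑ i ∈ range L, r i))
        (q ^ (r L * (r L + 1) / 2) • pochBinom q u t (r L))) B * levelProd q t u x r L (S \ B) *
          cross (qRatio q u) B (S \ B) =
        ∑ p ∈ antidiagonal #S, if #B = p.1 then (∏ i ∈ B, x i ^ L) * levelCoef q t r L p.1 *
          (∑ m ∈ piAntidiag (range L) p.2, (∏ j ∈ range L, levelCoef q t r j (m j)) *
            levelWord (qRatio q u) x m L (S \ B)) * cross (qRatio q u) B (S \ B) else 0 := by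
      intro B hB
      have hc := card_sdiff_add_card_eq_card (mem_powerset.1 hB)
      rw [sum_eq_single (#B, #(S \ B)), if_pos rfl, ← ih]
      · simp only [tw_apply, smul_apply, pochBinom, levelCoef, prod_const, pow_add, pow_mul]
        ring
      · rintro ⟨a, b⟩ hp hne
        rw [HasAntidiagonal.mem_antidiagonal] at hp
        rw [if_neg]
        rintro rfl
        exact hne (Prod.ext rfl (by simp only at hp ⊢; omega))
      · intro h
        exact absurd (HasAntidiagonal.mem_antidiagonal.2 (by simp only; omega)) h
    rw [levelProd, mul_apply, sum_congr rfl hA, sum_comm, range_add_one, ← cons_eq_insert _ _ hL,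
      piAntidiag_cons hL, sum_disjiUnion]
    refine sum_congr rfl fun p _ => ?_
    rw [sum_map]
    have hW : ∀ m ∈ piAntidiag (range L) p.2,
        (∏ j ∈ cons L (range L) hL, levelCoef q t r j
          (addRightEmbedding (fun j => if j = L then p.1 else 0) m j)) *
        levelWord (qRatio q u) x (addRightEmbedding (fun j => if j = L then p.1 else 0) m)
          (L + 1) S =
        ∑ B ∈ S.powerset, if #B = p.1 then (∏ i ∈ B, x i ^ L) * levelCoef q t r L p.1 *
          ((∏ j ∈ range L, levelCoef q t r j (m j)) *
            levelWord (qRatio q u) x m L (S \ B)) * cross (qRatio q u) B (S \ B) else 0 := by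
      intro m hm
      have hmL : m L = 0 := by
        by_contra h
        exact hL ((mem_piAntidiag.1 hm).2 L h)
      have hmj : ∀ j < L, addRightEmbedding (fun j => if j = L then p.1 else 0) m j = m j := by
        intro j hj
        simp [addRightEmbedding, hj.ne]
      have hmL' : addRightEmbedding (fun j => if j = L then p.1 else 0) m L = p.1 := by
        simp [addRightEmbedding, hmL]
      rw [prod_cons, levelWord, levelWord_congr _ _ L hmj, hmL', mul_apply, mul_sum,
        prod_congr rfl fun j hj => by rw [hmj j (mem_range.1 hj)]]
      refine sum_congr rfl fun B _ => ?_
      rw [tw_apply, ofCard_apply]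
      split_ifs
      · ring
      · ring
    rw [sum_congr rfl hW, sum_comm]
    refine sum_congr rfl fun B _ => ?_
    split_ifs
    · rw [mul_sum, sum_mul]
    · simp

end ShuffleAlg

section Words

open ShuffleAlg

variable {ι : Type*} [DecidableEq ι]

theorem tw_ofCard_one_mul_apply {c : ι → ι → ℂ} (y : ι → ℂ) (F : ShuffleAlg c) (S : Finset ι) :
    (tw y (ofCard 1) * F : ShuffleAlg c) S =
      ∑ i ∈ S, y i * F (S.erase i) * ∏ b ∈ S.erase i, c i b := by
  have h : ∀ B ∈ S.powerset, tw y (ofCard 1 : ShuffleAlg c) B * F (S \ B) * cross c B (S \ B) =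
      if #B = 1 then (∏ i ∈ B, y i) * F (S \ B) * cross c B (S \ B) else 0 := by
    intro B _; rw [tw_apply, ofCard_apply]; split_ifs <;> simp
  rw [mul_apply, sum_congr rfl h, ← sum_filter, ← powersetCard_eq_filter, powersetCard_one,
    sum_map]
  refine sum_congr rfl fun i _ => ?_
  simp [cross, sdiff_singleton_eq_erase]

/-- The product of the one-particle elements with weights `x i ^ p`, for `p` in a list. -/
def wordProd (c : ι → ι → ℂ) (x : ι → ℂ) (l : List ℕ) : ShuffleAlg c :=
  (l.map fun p => tw (fun i => x i ^ p) (ofCard 1)).prod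

/-- The weight of a configuration `g` in the expansion of `wordProd`. -/
def wordTerm (c : ι → ι → ℂ) (x : ι → ℂ) {n : ℕ} (μ : Fin n → ℕ) (g : Fin n → ι) : ℂ :=
  (∏ p ∈ (univ : Finset (Fin n × Fin n)).filter (fun p => p.1 < p.2), c (g p.1) (g p.2)) *
    ∏ i, x (g i) ^ μ i

theorem prod_filter_lt_succ {n : ℕ} (f : Fin (n + 1) → Fin (n + 1) → ℂ) :
    ∏ p ∈ (univ : Finset (Fin (n + 1) × Fin (n + 1))).filter (fun p => p.1 < p.2), f p.1 p.2 =
      (∏ j : Fin n, f 0 j.succ) *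
        ∏ p ∈ (univ : Finset (Fin n × Fin n)).filter (fun p => p.1 < p.2),
          f p.1.succ p.2.succ := by
  simp only [prod_filter, Fintype.prod_prod_type, Fin.prod_univ_succ]
  simp [Fin.succ_pos]

theorem wordTerm_cons (c : ι → ι → ℂ) (x : ι → ℂ) {n : ℕ} (μ : Fin (n + 1) → ℕ) (i : ι)
    (g : Fin n → ι) :
    wordTerm c x μ (Fin.cons i g : Fin (n + 1) → ι) =
      x i ^ μ 0 * (∏ j, c i (g j)) * wordTerm c x (fun j => μ j.succ) g := by
  rw [wordTerm, prod_filter_lt_succ (fun a b => c ((Fin.cons i g : Fin (n + 1) → ι) a)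
    ((Fin.cons i g : Fin (n + 1) → ι) b)), Fin.prod_univ_succ]
  simp only [Fin.cons_zero, Fin.cons_succ, wordTerm]
  ring

theorem wordProd_ofFn_apply [Fintype ι] (c : ι → ι → ℂ) (x : ι → ℂ) {n : ℕ} (μ : Fin n → ℕ)
    (S : Finset ι) :
    wordProd c x (List.ofFn μ) S =
      ∑ g : Fin n → ι, if Function.Injective g ∧ univ.image g = S then wordTerm c x μ g else 0 := by
  induction n generalizing S with
  | zero =>
    rw [Fintype.sum_unique]
    simp [wordProd, one_apply, wordTerm, Function.injective_of_subsingleton, eq_comm]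
  | succ n ih =>
    rw [List.ofFn_succ, wordProd, List.map_cons, List.prod_cons, ← wordProd,
      tw_ofCard_one_mul_apply, ← (Fin.consEquiv fun _ => ι).sum_comp, Fintype.sum_prod_type,
      ← sum_subset (subset_univ S)]
    · refine sum_congr rfl fun i hi => ?_
      rw [ih, mul_sum, sum_mul]
      refine sum_congr rfl fun g _ => ?_
      have hiff : (Function.Injective ((Fin.consEquiv fun _ => ι) (i, g) : Fin (n + 1) → ι) ∧
          univ.image ((Fin.consEquiv fun _ => ι) (i, g) : Fin (n + 1) → ι) = S) ↔
          Function.Injective g ∧ univ.image g = S.erase i := by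
        simp only [Fin.consEquiv, Equiv.coe_fn_mk]
        rw [Fin.cons_injective_iff]
        have him : univ.image (Fin.cons i g : Fin (n + 1) → ι) = insert i (univ.image g) := by
          ext a
          simp [Fin.exists_fin_succ, eq_comm]
        rw [him]
        constructor
        · rintro ⟨⟨h1, h2⟩, h3⟩
          refine ⟨h2, ?_⟩
          rw [← h3, erase_insert]
          simpa using h1
        · rintro ⟨h2, h3⟩
          refine ⟨⟨?_, h2⟩, ?_⟩
          · intro h
            have : i ∈ univ.image g := by simpa using h
            rw [h3] at this
            simp at this
          · rw [h3, insert_erase hi]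
      by_cases h : Function.Injective g ∧ univ.image g = S.erase i
      · rw [if_pos h, if_pos (hiff.2 h), ← h.2, prod_image fun a _ b _ hab => h.1 hab]
        simp only [Fin.consEquiv, Equiv.coe_fn_mk]
        rw [wordTerm_cons]
        ring
      · rw [if_neg h, if_neg (hiff.not.2 h)]
        simp
    · intro i _ hi
      refine sum_eq_zero fun g _ => if_neg ?_
      rintro ⟨-, h⟩
      refine hi (h ▸ mem_image.2 ⟨0, mem_univ _, ?_⟩)
      simp [Fin.consEquiv]

/-- The weakly decreasing list in which each `j < L` appears `m j` times. -/
def descList (m : ℕ → ℕ) : ℕ → List ℕ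
  | 0 => []
  | L + 1 => List.replicate (m L) L ++ descList m L

theorem length_descList (m : ℕ → ℕ) (L : ℕ) : (descList m L).length = ∑ j ∈ range L, m j := by
  induction L with
  | zero => rfl
  | succ L ih => simp [descList, ih, sum_range_succ, add_comm]

theorem mem_descList_lt (m : ℕ → ℕ) {L a : ℕ} (h : a ∈ descList m L) : a < L := by
  induction L with
  | zero => simp [descList] at h
  | succ L ih =>
    rcases List.mem_append.1 h with h | h
    · rw [List.eq_of_mem_replicate h]; omega
    · exact (ih h).trans (Nat.lt_succ_self L)

theorem count_descList (m : ℕ → ℕ) (L a : ℕ) :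
    (descList m L).count a = if a < L then m a else 0 := by
  induction L with
  | zero => simp [descList]
  | succ L ih =>
    rw [descList, List.count_append, ih, List.count_replicate]
    by_cases h : a = L
    · simp [h]
    · have : L ≠ a := fun h' => h h'.symm
      have h2 : a < L + 1 ↔ a < L := by omega
      simp [this, h2]

theorem pairwise_descList (m : ℕ → ℕ) (L : ℕ) : (descList m L).Pairwise (· ≥ ·) := by
  induction L with
  | zero => simp [descList]
  | succ L ih =>
    rw [descList, List.pairwise_append]
    refine ⟨?_, ih, ?_⟩
    · rw [List.pairwise_replicate]; right; exact le_rfl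
    · intro a ha b hb
      rw [List.eq_of_mem_replicate ha]
      exact (mem_descList_lt m hb).le

theorem count_ofFn {n : ℕ} (μ : Fin n → ℕ) (a : ℕ) : (List.ofFn μ).count a = mult μ a := by
  induction n with
  | zero => simp [mult]
  | succ n ih =>
    rw [List.ofFn_succ, List.count_cons, ih, mult, mult, Fin.card_filter_univ_succ]
    by_cases h : μ 0 = a <;> simp [h]

theorem ofFn_eq_descList {n L : ℕ} (μ : Fin n → ℕ) (hμ : ∀ i j, i ≤ j → μ j ≤ μ i)
    (hL : ∀ i, μ i < L) : List.ofFn μ = descList (mult μ) L := by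
  refine List.Perm.eq_of_pairwise (le := (· ≥ ·)) (fun a b _ _ h1 h2 => le_antisymm h2 h1) ?_
    (pairwise_descList _ _) ?_
  · rw [List.pairwise_ofFn]
    exact fun i j hij => hμ i j hij.le
  · rw [List.perm_iff_count]
    intro a
    rw [count_ofFn, count_descList]
    split_ifs with h
    · rfl
    · rw [mult, card_eq_zero, filter_eq_empty_iff]
      intro i _ hi
      exact h (hi ▸ hL i)

theorem wordProd_append (c : ι → ι → ℂ) (x : ι → ℂ) (l l' : List ℕ) :
    wordProd c x (l ++ l') = wordProd c x l * wordProd c x l' := by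
  simp [wordProd]

theorem wordProd_descList {q : ℂ} {u : ι → ℂ} (hu : Function.Injective u) (h0 : ∀ i, u i ≠ 0)
    (hq1 : q ≠ 1) (x : ι → ℂ) (m : ℕ → ℕ) (L : ℕ) :
    wordProd (qRatio q u) x (descList m L) =
      (∏ j ∈ range L, qPoch q q (m j) / (1 - q) ^ m j) • levelWord (qRatio q u) x m L := by
  induction L with
  | zero => simp [wordProd, descList, levelWord]
  | succ L ih =>
    rw [descList, wordProd_append, ih, wordProd, List.map_replicate, List.prod_replicate,
      ← tw_pow, ofCard_one_pow hu h0 hq1, tw_smul, levelWord, smul_mul_smul_comm, prod_range_succ,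
      mul_comm]

end Words

section Observable

theorem sum_strictMono_succ {n k : ℕ} (F : (Fin (k + 1) → Fin (n + 1)) → ℂ) :
    ∑ f with StrictMono f, F f =
      ∑ f : Fin (k + 1) → Fin n with StrictMono f, F (fun p => (f p).succ) +
        ∑ f : Fin k → Fin n with StrictMono f, F (Fin.cons 0 fun p => (f p).succ) := by
  rw [← sum_filter_add_sum_filter_not _ (fun f : Fin (k + 1) → Fin (n + 1) => f 0 ≠ 0)]
  congr 1
  · symm
    refine sum_bij (fun f _ => fun p => (f p).succ) ?_ ?_ ?_ (fun _ _ => rfl)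
    · intro f hf
      simp only [mem_filter, mem_univ, true_and] at hf ⊢
      exact ⟨fun a b hab => Fin.succ_lt_succ_iff.2 (hf hab), Fin.succ_ne_zero _⟩
    · intro f _ g _ h
      funext p
      exact Fin.succ_injective _ (congrFun h p)
    · intro f hf
      simp only [mem_filter, mem_univ, true_and] at hf
      have h0 : ∀ p, f p ≠ 0 := fun p h =>
        hf.2 (le_antisymm (h ▸ hf.1.monotone (Fin.zero_le p)) (Fin.zero_le _))
      refine ⟨fun p => (f p).pred (h0 p), ?_, ?_⟩
      · simp only [mem_filter, mem_univ, true_and]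
        exact fun a b hab => Fin.pred_lt_pred_iff.2 (hf.1 hab)
      · funext p; simp
  · symm
    refine sum_bij (fun f _ => Fin.cons 0 fun p => (f p).succ) ?_ ?_ ?_ (fun _ _ => rfl)
    · intro f hf
      simp only [mem_filter, mem_univ, true_and, Fin.cons_zero, ne_eq, not_true, not_false_eq_true,
        and_true] at hf ⊢
      intro a b hab
      induction b using Fin.cases with
      | zero => exact absurd hab (Fin.not_lt_zero a)
      | succ b =>
        induction a using Fin.cases with
        | zero => simp
        | succ a =>
          simp only [Fin.cons_succ, Fin.succ_lt_succ_iff]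
          exact hf (Fin.succ_lt_succ_iff.1 hab)
    · intro f _ g _ h
      funext p
      exact Fin.succ_injective _ (congrFun (Fin.cons_right_injective _ h) p)
    · intro f hf
      simp only [mem_filter, mem_univ, true_and, ne_eq, not_not] at hf
      have h0 : ∀ p : Fin k, f p.succ ≠ 0 := fun p h => by
        have := hf.1 (Fin.succ_pos p)
        rw [h] at this
        exact absurd this (Fin.not_lt_zero _)
      refine ⟨fun p => (f p.succ).pred (h0 p), ?_, ?_⟩
      · simp only [mem_filter, mem_univ, true_and]
        exact fun a b hab => Fin.pred_lt_pred_iff.2 (hf.1 (Fin.succ_lt_succ_iff.2 hab))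
      · funext p
        induction p using Fin.cases with
        | zero => simp [hf.2]
        | succ p => simp

theorem Qobs_eq_sum_strictMono (q : ℂ) {n k : ℕ} (θ : Fin k → ℕ) (ν : Fin n → ℕ) :
    Qobs q θ ν = ∑ f : Fin k → Fin n with StrictMono f,
      if ∀ p, ν (f p) = θ p then q ^ (∑ p, ((f p : ℕ) + 1)) else 0 := by
  rw [Qobs]
  refine sum_bij (fun I _ => I.1.orderEmbOfFin (mem_powersetCard.1 I.2).2) ?_ ?_ ?_ ?_
  · intro I _
    simpa using (I.1.orderEmbOfFin (mem_powersetCard.1 I.2).2).strictMono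
  · intro I _ J _ h
    refine Subtype.ext (coe_injective ?_)
    rw [← range_orderEmbOfFin I.1 (mem_powersetCard.1 I.2).2,
      ← range_orderEmbOfFin J.1 (mem_powersetCard.1 J.2).2, h]
  · intro f hf
    simp only [mem_filter, mem_univ, true_and] at hf
    have hc : #(univ.image f) = k := by simp [card_image_of_injective _ hf.injective]
    refine ⟨⟨univ.image f, mem_powersetCard.2 ⟨subset_univ _, hc⟩⟩, mem_attach _ _, ?_⟩
    exact (orderEmbOfFin_unique hc (fun x => mem_image_of_mem _ (mem_univ x)) hf).symm
  · intro I _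
    have h : ∑ i ∈ I.1, ((i : ℕ) + 1) =
        ∑ p, ((I.1.orderEmbOfFin (mem_powersetCard.1 I.2).2 p : ℕ) + 1) := by
      conv_lhs => rw [← map_orderEmbOfFin_univ I.1 (mem_powersetCard.1 I.2).2]
      rw [sum_map]; rfl
    rw [h]

/-- The sum of `q ^ (i₁ + ⋯ + i_k)` over the occurrences, at positions `i₁ < ⋯ < i_k`, of the
first list as a sublist of the second one. -/
def sublistSum (q : ℂ) : List ℕ → List ℕ → ℂ
  | [], _ => 1
  | _ :: _, [] => 0
  | b :: θ, a :: μ =>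
    q ^ (θ.length + 1) * (sublistSum q (b :: θ) μ + if a = b then sublistSum q θ μ else 0)

theorem Qobs_eq_sublistSum (q : ℂ) {n k : ℕ} (θ : Fin k → ℕ) (ν : Fin n → ℕ) :
    Qobs q θ ν = sublistSum q (List.ofFn θ) (List.ofFn ν) := by
  induction n generalizing k with
  | zero =>
    rw [Qobs_eq_sum_strictMono]
    cases k with
    | zero =>
      rw [sum_filter, Fintype.sum_unique]
      simp [sublistSum, Subsingleton.strictMono]
    | succ k => simp [List.ofFn_succ, sublistSum]
  | succ n ih =>
    cases k with
    | zero =>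
      rw [Qobs_eq_sum_strictMono, sum_filter, Fintype.sum_unique]
      simp [sublistSum, Subsingleton.strictMono]
    | succ k =>
      rw [Qobs_eq_sum_strictMono, sum_strictMono_succ, List.ofFn_succ (f := θ),
        List.ofFn_succ (f := ν), sublistSum, ← List.ofFn_succ (f := θ), ← ih, ← ih,
        List.length_ofFn, mul_add, Qobs_eq_sum_strictMono, mul_sum]
      congr 1
      · refine sum_congr rfl fun f _ => ?_
        rw [mul_ite, mul_zero, ← pow_add]
        congr 2
        simp [sum_add_distrib]
        ring
      · rw [Qobs_eq_sum_strictMono]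
        by_cases h : ν 0 = θ 0
        · rw [if_pos h, mul_sum]
          refine sum_congr rfl fun f _ => ?_
          rw [mul_ite, mul_zero, ← pow_add]
          refine if_congr ?_ ?_ rfl
          · simp [Fin.forall_fin_succ, h]
          · congr 1
            simp [sum_add_distrib, Fin.sum_univ_succ]
            ring
        · rw [if_neg h, mul_zero]
          refine sum_eq_zero fun f _ => if_neg fun hf => h ?_
          simpa using hf 0

theorem sublistSum_cons_eq_zero (q : ℂ) (b : ℕ) (θ μ : List ℕ) (h : b ∉ μ) :
    sublistSum q (b :: θ) μ = 0 := by
  induction μ with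
  | nil => rfl
  | cons a μ ih =>
    simp only [List.mem_cons, not_or] at h
    rw [sublistSum, ih h.2, if_neg (Ne.symm h.1)]
    simp

theorem triangle_succ (r : ℕ) : (r + 1) * (r + 1 + 1) / 2 = r * (r + 1) / 2 + (r + 1) := by
  rw [triangle_add r 1]
  omega

theorem sublistSum_replicate_append {q : ℂ} (hq : ∀ m : ℕ, q ^ (m + 1) ≠ 1) (j r m : ℕ)
    (θ μ : List ℕ) (hθ : ∀ a ∈ θ, a < j) (hμ : ∀ a ∈ μ, a < j) :
    sublistSum q (List.replicate r j ++ θ) (List.replicate m j ++ μ) =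
      qBinom q m r * q ^ (r * (r + 1) / 2 + θ.length * m) * sublistSum q θ μ := by
  induction m generalizing r with
  | zero =>
    cases r with
    | zero => simp [qBinom_zero hq]
    | succ r =>
      rw [qBinom_of_lt q (Nat.succ_pos r), List.replicate_succ, List.cons_append,
        List.replicate_zero, List.nil_append, sublistSum_cons_eq_zero]
      · simp
      · exact fun h => lt_irrefl _ (hμ j h)
  | succ m ih =>
    cases r with
    | zero =>
      have := ih 0
      rw [qBinom_zero hq] at this ⊢
      cases θ with
      | nil => simp [sublistSum]
      | cons b θ =>
        have hb : j ≠ b := (hθ b (by simp)).ne'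
        simp only [List.replicate_zero, List.nil_append] at this ⊢
        rw [List.replicate_succ, List.cons_append, sublistSum, this, if_neg hb]
        simp only [List.length_cons]
        ring
    | succ r =>
      have h1 := ih r
      have h2 := ih (r + 1)
      rw [List.replicate_succ, List.cons_append] at h2
      rw [List.replicate_succ, List.replicate_succ, List.cons_append, List.cons_append, sublistSum,
        h1, h2, if_pos rfl, qBinom_succ_succ hq, triangle_succ, List.length_append,
        List.length_replicate]
      ring

theorem sublistSum_descList {q : ℂ} (hq : ∀ m : ℕ, q ^ (m + 1) ≠ 1) (r m : ℕ → ℕ) (L : ℕ) :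
    sublistSum q (descList r L) (descList m L) = ∏ j ∈ range L,
      (qBinom q (m j) (r j) * q ^ (r j * (r j + 1) / 2 + (∑ i ∈ range j, r i) * m j)) := by
  induction L with
  | zero => simp [descList, sublistSum]
  | succ L ih =>
    rw [descList, descList, sublistSum_replicate_append hq _ _ _ _ _
      (fun a => mem_descList_lt r) (fun a => mem_descList_lt m), ih, length_descList,
      prod_range_succ, mul_comm]

theorem Qobs_add_one (q : ℂ) {n k : ℕ} (θ : Fin k → ℕ) (ν : Fin n → ℕ) :
    Qobs q (fun i => θ i + 1) (fun i => ν i + 1) = Qobs q θ ν := by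
  simp [Qobs]

end Observable

section Weights

open ShuffleAlg

variable {ι : Type*} [DecidableEq ι] [Fintype ι]

theorem sum_perm_comp_injective {M : Type*} [AddCommMonoid M] {k : ℕ} {g : Fin k → ι}
    (hg : Function.Injective g) (F : (Fin k → ι) → M) :
    ∑ σ : Equiv.Perm (Fin k), F (g ∘ σ) =
      ∑ f with Function.Injective f ∧ univ.image f = univ.image g, F f := by
  refine sum_bij (fun σ _ => g ∘ σ) ?_ ?_ ?_ (fun _ _ => rfl)
  · intro σ _
    simp only [mem_filter, mem_univ, true_and]
    refine ⟨hg.comp σ.injective, ?_⟩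
    rw [← image_image, image_univ_equiv]
  · intro σ _ τ _ h
    ext i
    exact congrArg _ (hg (congrFun h i))
  · intro f hf
    simp only [mem_filter, mem_univ, true_and] at hf
    have h : ∀ i, ∃ j, g j = f i := fun i => by
      have : f i ∈ univ.image g := hf.2 ▸ mem_image_of_mem _ (mem_univ i)
      simpa using this
    choose σ hσ using h
    have hinj : Function.Injective σ := fun a b hab => hf.1 (by rw [← hσ, ← hσ, hab])
    exact ⟨Equiv.ofBijective σ (Finite.injective_iff_bijective.1 hinj), mem_univ _, funext hσ⟩

theorem sum_perm_wordTerm (c : ι → ι → ℂ) (x : ι → ℂ) {k : ℕ} (μ : Fin k → ℕ) {g : Fin k → ι}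
    (hg : Function.Injective g) :
    ∑ σ : Equiv.Perm (Fin k), wordTerm c x μ (g ∘ σ) =
      wordProd c x (List.ofFn μ) (univ.image g) := by
  rw [wordProd_ofFn_apply, ← sum_filter, sum_perm_comp_injective hg]

theorem neg_pow_mul_Ffun (q s : ℂ) (u : ι → ℂ) {k : ℕ} (μ : Fin k → ℕ) {g : Fin k → ι}
    (hg : Function.Injective g) :
    (-s) ^ (∑ i, μ i) * Ffun q s μ (fun i => u (g i)) =
      (1 - q) ^ k / (∏ i, (1 - s * u (g i))) *
        wordProd (qRatio q u) (fun i => -s * ((u i - s) / (1 - s * u i))) (List.ofFn μ)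
          (univ.image g) := by
  rw [← sum_perm_wordTerm _ _ _ hg, Ffun, mul_left_comm, mul_sum]
  congr 1
  refine sum_congr rfl fun σ _ => ?_
  have h : (∏ i, ((u (g (σ i)) - s) / (1 - s * u (g (σ i)))) ^ μ i) * (-s) ^ (∑ i, μ i) =
      ∏ i, (-s * ((u (g (σ i)) - s) / (1 - s * u (g (σ i))))) ^ μ i := by
    rw [← prod_pow_eq_pow_sum, ← prod_mul_distrib]
    exact prod_congr rfl fun i _ => by rw [mul_pow, mul_comm]
  rw [wordTerm]
  simp only [Function.comp_apply]
  rw [← h]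
  simp only [qRatio]
  ring

theorem sum_mult {k L : ℕ} (μ : Fin k → ℕ) (hL : ∀ i, μ i < L) :
    ∑ j ∈ range L, mult μ j = k := by
  have := card_eq_sum_card_fiberwise (f := μ) (s := univ) (t := range L)
    (fun i _ => by simpa using hL i)
  simpa [mult] using this.symm

theorem mult_eq_zero {k L : ℕ} (μ : Fin k → ℕ) (hL : ∀ i, μ i < L) {j : ℕ} (hj : L ≤ j) :
    mult μ j = 0 := by
  rw [mult, card_eq_zero, filter_eq_empty_iff]
  intro i _ hi
  exact absurd (hL i) (by omega)

theorem cconst_eq_prod (q s : ℂ) {k L : ℕ} (μ : Fin k → ℕ) (hL : ∀ i, μ i < L) :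
    cconst q s μ = ∏ j ∈ range L, qPoch (s ^ 2) q (mult μ j) / qPoch q q (mult μ j) := by
  rw [cconst]
  refine finprod_eq_prod_of_mulSupport_subset _ fun j hj => ?_
  by_contra h
  refine hj ?_
  simp only [coe_range, Set.mem_Iio, not_lt] at h
  simp [mult_eq_zero μ hL h, qPoch]

theorem neg_pow_mul_Fc {q : ℂ} (hq : ∀ m : ℕ, q ^ (m + 1) ≠ 1) (s : ℂ) {u : ι → ℂ}
    (hu : Function.Injective u) (h0 : ∀ i, u i ≠ 0) {k L : ℕ} (μ : Fin k → ℕ)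
    (hμ : ∀ i j, i ≤ j → μ j ≤ μ i) (hL : ∀ i, μ i < L) {g : Fin k → ι}
    (hg : Function.Injective g) :
    (-s) ^ (∑ i, μ i) * Fc q s μ (fun i => u (g i)) =
      (∏ i, (1 - s * u (g i)))⁻¹ *
        markedProd q (s ^ 2) u (fun i => -s * ((u i - s) / (1 - s * u i))) (mult μ) L
          (univ.image g) := by
  have hq1 : q ≠ 1 := by simpa using hq 0
  rw [Fc, mul_left_comm, neg_pow_mul_Ffun q s u μ hg, ofFn_eq_descList μ hμ hL,
    wordProd_descList hu h0 hq1, markedProd_eq, cconst_eq_prod q s μ hL, ShuffleAlg.smul_apply,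
    ShuffleAlg.smul_apply]
  have h : (∏ j ∈ range L, qPoch (s ^ 2) q (mult μ j)) =
      (∏ j ∈ range L, qPoch (s ^ 2) q (mult μ j) / qPoch q q (mult μ j)) * (1 - q) ^ k *
        ∏ j ∈ range L, qPoch q q (mult μ j) / (1 - q) ^ mult μ j := by
    nth_rewrite 4 [← sum_mult μ hL]
    rw [← prod_pow_eq_pow_sum, ← prod_mul_distrib, ← prod_mul_distrib]
    refine prod_congr rfl fun j _ => ?_
    have h1 := qPoch_self_ne_zero hq (mult μ j)
    have h2 : (1 - q) ^ mult μ j ≠ 0 := pow_ne_zero _ (sub_ne_zero.2 hq1.symm)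
    field_simp
  rw [h]
  ring

theorem weight_mul_Qobs {q : ℂ} (hq : ∀ m : ℕ, q ^ (m + 1) ≠ 1) (s : ℂ) {n k L : ℕ}
    {u : Fin n → ℂ} (hu : Function.Injective u) (h0 : ∀ i, u i ≠ 0) (μ : Fin n → ℕ)
    (hμ : ∀ i j, i ≤ j → μ j ≤ μ i) (hL : ∀ i, μ i < L) (θ : Fin k → ℕ)
    (hθ : ∀ i j, i ≤ j → θ j ≤ θ i) (hθL : ∀ i, θ i < L) :
    (-s) ^ (∑ i, μ i) * Fc q s μ u * Qobs q θ μ =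
      (∏ i, (1 - s * u i))⁻¹ * ((∏ j ∈ range L, levelCoef q (s ^ 2) (mult θ) j (mult μ j)) *
        levelWord (qRatio q u) (fun i => -s * ((u i - s) / (1 - s * u i))) (mult μ) L univ) := by
  have h := neg_pow_mul_Fc hq s hu h0 μ hμ hL Function.injective_id
  simp only [id] at h
  rw [h, image_id, markedProd_eq, Qobs_eq_sublistSum, ofFn_eq_descList μ hμ hL,
    ofFn_eq_descList θ hθ hθL, sublistSum_descList hq, ShuffleAlg.smul_apply]
  simp only [levelCoef, mul_assoc, prod_mul_distrib]
  ring

/-- The signatures of length `n` all of whose parts are less than `L`. -/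
def boxSign (n L : ℕ) : Finset (Sign n) :=
  (Fintype.piFinset fun _ : Fin n => range L).subtype _

theorem mem_boxSign {n L : ℕ} {μ : Sign n} : μ ∈ boxSign n L ↔ ∀ i, μ.1 i < L := by
  simp [boxSign]

theorem sum_boxSign_mult (n L : ℕ) (f : (ℕ → ℕ) → ℂ) :
    ∑ μ ∈ boxSign n L, f (mult μ.1) = ∑ m ∈ piAntidiag (range L) n, f m := by
  refine sum_bij (fun μ _ => mult μ.1) ?_ ?_ ?_ (fun _ _ => rfl)
  · intro μ hμ
    rw [mem_boxSign] at hμ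
    refine mem_piAntidiag.2 ⟨sum_mult _ hμ, fun j hj => ?_⟩
    by_contra h
    exact hj (mult_eq_zero _ hμ (by simpa using h))
  · intro μ hμ ν hν h
    rw [mem_boxSign] at hμ hν
    refine Subtype.ext (List.ofFn_injective ?_)
    rw [ofFn_eq_descList _ μ.2 hμ, ofFn_eq_descList _ ν.2 hν]
    exact congrArg (descList · L) h
  · intro m hm
    rw [mem_piAntidiag] at hm
    have hlen : (descList m L).length = n := (length_descList m L).trans hm.1
    subst hlen
    refine ⟨⟨(descList m L).get, fun i j hij => ?_⟩, ?_, ?_⟩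
    · rcases hij.eq_or_lt with h | h
      · rw [h]
      · exact List.pairwise_iff_get.1 (pairwise_descList m L) i j h
    · exact mem_boxSign.2 fun i => mem_descList_lt m (List.get_mem _ _)
    · funext a
      rw [← count_ofFn, List.ofFn_get, count_descList]
      split_ifs with h
      · rfl
      · by_contra h1
        exact h (by simpa using hm.2 a (Ne.symm h1))

theorem sum_boxSign_weight {q : ℂ} (hq : ∀ m : ℕ, q ^ (m + 1) ≠ 1) (s : ℂ) {n k L : ℕ}
    {u : Fin n → ℂ} (hu : Function.Injective u) (h0 : ∀ i, u i ≠ 0) (θ : Fin k → ℕ)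
    (hθ : ∀ i j, i ≤ j → θ j ≤ θ i) (hθL : ∀ i, θ i < L) :
    ∑ μ ∈ boxSign n L, (-s) ^ (∑ i, μ.1 i) * Fc q s μ.1 u * Qobs q θ μ.1 =
      (∏ i, (1 - s * u i))⁻¹ *
        levelProd q (s ^ 2) u (fun i => -s * ((u i - s) / (1 - s * u i))) (mult θ) L univ := by
  rw [levelProd_apply, mul_sum, card_univ, Fintype.card_fin, ← sum_boxSign_mult]
  exact sum_congr rfl fun μ hμ =>
    weight_mul_Qobs hq s hu h0 μ.1 μ.2 (mem_boxSign.1 hμ) θ hθ hθL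

end Weights

section Summability

open ShuffleAlg Filter

theorem summable_pow_sum {ρ : ℝ} (h0 : 0 ≤ ρ) (h1 : ρ < 1) (n : ℕ) :
    Summable fun f : Fin n → ℕ => ρ ^ (∑ i, f i) := by
  induction n with
  | zero => exact Summable.of_finite
  | succ n ih =>
    rw [← (Fin.consEquiv fun _ => ℕ).summable_iff]
    refine ((summable_geometric_of_lt_one h0 h1).mul_of_nonneg ih (fun _ => pow_nonneg h0 _)
      (fun _ => pow_nonneg h0 _)).congr fun p => ?_
    simp [Fin.consEquiv, Fin.sum_univ_succ, pow_add]

theorem norm_Qobs_le (q : ℂ) (n k : ℕ) :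
    ∃ D : ℝ, ∀ (θ : Fin k → ℕ) (ν : Fin n → ℕ), ‖Qobs q θ ν‖ ≤ D := by
  refine ⟨∑ I ∈ (powersetCard k (univ : Finset (Fin n))).attach,
    ‖q ^ (∑ i ∈ I.1, ((i : ℕ) + 1))‖, fun θ ν => ?_⟩
  refine (norm_sum_le _ _).trans (sum_le_sum fun I _ => ?_)
  split_ifs
  · exact le_rfl
  · simp

theorem norm_cconst_le (q s : ℂ) (n : ℕ) : ∃ D : ℝ, ∀ μ : Fin n → ℕ, ‖cconst q s μ‖ ≤ D := by
  let B : ℝ := 1 + ∑ m ∈ range (n + 1), ‖qPoch (s ^ 2) q m / qPoch q q m‖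
  have hB1 : 1 ≤ B := le_add_of_nonneg_right (sum_nonneg fun _ _ => norm_nonneg _)
  refine ⟨B ^ n, fun μ => ?_⟩
  obtain ⟨L, hL⟩ : ∃ L, ∀ i, μ i < L :=
    ⟨univ.sup μ + 1, fun i => Nat.lt_succ_of_le (le_sup (mem_univ i))⟩
  have hn : B ^ n = ∏ j ∈ range L, B ^ mult μ j := by rw [prod_pow_eq_pow_sum, sum_mult μ hL]
  rw [cconst_eq_prod q s μ hL, norm_prod, hn]
  refine prod_le_prod (fun _ _ => norm_nonneg _) fun j _ => ?_
  rcases Nat.eq_zero_or_pos (mult μ j) with h | h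
  · simp [h, qPoch]
  · have hm : mult μ j ∈ range (n + 1) := by
      have : mult μ j ≤ n := (card_le_univ _).trans_eq (Fintype.card_fin n)
      exact mem_range.2 (by omega)
    have h2 : ‖qPoch (s ^ 2) q (mult μ j) / qPoch q q (mult μ j)‖ ≤ B :=
      (single_le_sum (f := fun m => ‖qPoch (s ^ 2) q m / qPoch q q m‖)
        (fun _ _ => norm_nonneg _) hm).trans (le_add_of_nonneg_left zero_le_one)
    refine h2.trans ?_
    exact le_self_pow₀ hB1 h.ne'

theorem norm_sum_wordTerm_le {ι : Type*} (c : ι → ι → ℂ) (x : ι → ℂ) {ρ : ℝ}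
    (hρ : ∀ i, ‖x i‖ ≤ ρ) (n : ℕ) (G : Finset (Fin n → ι)) :
    ∃ D : ℝ, ∀ μ : Fin n → ℕ, ‖∑ g ∈ G, wordTerm c x μ g‖ ≤ D * ρ ^ (∑ i, μ i) := by
  refine ⟨∑ g ∈ G, ‖∏ p ∈ (univ : Finset (Fin n × Fin n)).filter (fun p => p.1 < p.2),
    c (g p.1) (g p.2)‖, fun μ => ?_⟩
  rw [sum_mul]
  refine (norm_sum_le _ _).trans (sum_le_sum fun g _ => ?_)
  rw [wordTerm, norm_mul]
  refine mul_le_mul_of_nonneg_left ?_ (norm_nonneg _)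
  rw [norm_prod, ← prod_pow_eq_pow_sum]
  refine prod_le_prod (fun _ _ => norm_nonneg _) fun i _ => ?_
  rw [norm_pow]
  exact pow_le_pow_left₀ (norm_nonneg _) (hρ _) _

theorem summable_weight {q : ℂ} (s : ℂ) {n k : ℕ} (u : Fin n → ℂ)
    (hx1 : ∀ i, ‖-s * ((u i - s) / (1 - s * u i))‖ < 1) (θ : Fin k → ℕ) :
    Summable fun μ : Sign n => (-s) ^ (∑ i, μ.1 i) * Fc q s μ.1 u * Qobs q θ μ.1 := by
  obtain ⟨ρ, h0, h1, hρ⟩ : ∃ ρ : ℝ, 0 ≤ ρ ∧ ρ < 1 ∧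
      ∀ i, ‖-s * ((u i - s) / (1 - s * u i))‖ ≤ ρ := by
    rcases isEmpty_or_nonempty (Fin n) with h | h
    · exact ⟨0, le_rfl, one_pos, fun i => h.elim i⟩
    · obtain ⟨i, hi⟩ := Finite.exists_max fun i => ‖-s * ((u i - s) / (1 - s * u i))‖
      exact ⟨_, norm_nonneg _, hx1 i, hi⟩
  obtain ⟨D1, hD1⟩ := norm_Qobs_le q n k
  obtain ⟨D2, hD2⟩ := norm_cconst_le q s n
  obtain ⟨D3, hD3⟩ := norm_sum_wordTerm_le (qRatio q u) _ hρ n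
    (univ.image fun σ : Equiv.Perm (Fin n) => (σ : Fin n → Fin n))
  have hS : Summable fun μ : Sign n => ρ ^ (∑ i, μ.1 i) :=
    (summable_pow_sum h0 h1 n).comp_injective Subtype.val_injective
  refine Summable.of_norm_bounded
    (hS.mul_left (‖(1 - q) ^ n / (∏ i, (1 - s * u i))‖ * D3 * D2 * D1)) fun μ => ?_
  have hw := hD3 μ.1
  rw [sum_image fun σ _ τ _ h => DFunLike.coe_injective h] at hw
  have hF := neg_pow_mul_Ffun q s u μ.1 Function.injective_id
  rw [← sum_perm_wordTerm _ _ _ Function.injective_id] at hF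
  simp only [id, Function.id_comp] at hF
  have e : (-s) ^ (∑ i, μ.1 i) * Fc q s μ.1 u * Qobs q θ μ.1 =
      ((-s) ^ (∑ i, μ.1 i) * Ffun q s μ.1 u) * cconst q s μ.1 * Qobs q θ μ.1 := by
    rw [Fc]; ring
  rw [e, hF, norm_mul, norm_mul, norm_mul]
  have hD3' : 0 ≤ D3 * ρ ^ (∑ i, μ.1 i) := (norm_nonneg _).trans hw
  calc _ ≤ ‖(1 - q) ^ n / (∏ i, (1 - s * u i))‖ * (D3 * ρ ^ (∑ i, μ.1 i)) * D2 * D1 := by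
        have := (norm_nonneg _).trans (hD2 μ.1)
        gcongr
        · exact hD2 μ.1
        · exact hD1 θ μ.1
    _ = _ := by ring

theorem hasSum_weight {q : ℂ} (hq : ∀ m : ℕ, q ^ (m + 1) ≠ 1) (hqn : ‖q‖ < 1) (s : ℂ)
    {n k L₀ : ℕ} {u : Fin n → ℂ} (hu : Function.Injective u) (h0 : ∀ i, u i ≠ 0)
    (h1 : ∀ i, 1 - s * u i ≠ 0)
    (hx1 : ∀ i, ‖-s * ((u i - s) / (1 - s * u i))‖ < 1) (θ : Fin k → ℕ)
    (hθ : ∀ i j, i ≤ j → θ j ≤ θ i) (hθL : ∀ i, θ i < L₀) :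
    HasSum (fun μ : Sign n => (-s) ^ (∑ i, μ.1 i) * Fc q s μ.1 u * Qobs q θ μ.1)
      ((∏ i, (1 - s * u i))⁻¹ * (q ^ (k * (k + 1) / 2) *
        (markedProd q (s ^ 2) u (fun i => -s * ((u i - s) / (1 - s * u i))) (mult θ) L₀ *
          affProd q u (-s) 1 : ShuffleAlg (qRatio q u)) univ)) := by
  have hs := summable_weight (q := q) s u hx1 θ
  have hlim : Tendsto (fun L => boxSign n L) atTop atTop := by
    refine tendsto_atTop_finset_of_monotone ?_ ?_
    · intro L L' hL μ hμ
      rw [mem_boxSign] at hμ ⊢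
      exact fun i => (hμ i).trans_le hL
    · intro μ
      exact ⟨univ.sup μ.1 + 1, mem_boxSign.2 fun i => Nat.lt_succ_of_le (le_sup (mem_univ i))⟩
  have hx : ∀ i, -s * ((u i - s) / (1 - s * u i)) * (-s * u i + 1) = -s * u i + s ^ 2 := by
    intro i
    have := h1 i
    have e : -s * u i + 1 = 1 - s * u i := by ring
    rw [e, mul_assoc, div_mul_cancel₀ _ this]
    ring
  have hlev := (tendsto_levelProd hu h0 hq hqn (-s) hx hx1 (L₀ := L₀) (k := k)
    (fun j hj => mult_eq_zero θ hθL hj) (sum_mult θ hθL) univ).const_mul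
      (∏ i, (1 - s * u i))⁻¹
  have hval := tendsto_nhds_unique (hs.hasSum.comp hlim) (hlev.congr' ?_)
  · rw [← hval]
    exact hs.hasSum
  · filter_upwards [eventually_ge_atTop L₀] with L hL
    exact (sum_boxSign_weight hq s hu h0 θ hθ fun i => (hθL i).trans_le hL).symm

theorem hasSum_Mwt_mul_Qobs {q s : ℂ} {n k : ℕ} {u : Fin n → ℂ} {θ : Fin k → ℕ} {V : ℂ}
    (h : HasSum (fun μ : Sign n => (-s) ^ (∑ i, μ.1 i) * Fc q s μ.1 u * Qobs q θ μ.1) V) :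
    HasSum (fun ν : Sign n => Mwt q s u ν.1 * Qobs q (fun i => θ i + 1) ν.1) V := by
  let sh : Sign n → Sign n := fun μ =>
    ⟨fun i => μ.1 i + 1, fun i j hij => Nat.add_le_add_right (μ.2 i j hij) 1⟩
  have hsh : Function.Injective sh := by
    intro μ ν hμν
    refine Subtype.ext (funext fun i => ?_)
    have := congrFun (congrArg Subtype.val hμν) i
    simpa [sh] using this
  rw [← hsh.hasSum_iff]
  · refine h.congr_fun ?_
    intro μ
    simp only [Function.comp_apply, sh, Qobs_add_one, Mwt]
    simp [sum_add_distrib]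
  · intro ν hν
    have : ¬ ∀ i, 1 ≤ ν.1 i := by
      intro h1
      refine hν ⟨⟨fun i => ν.1 i - 1, fun i j hij => Nat.sub_le_sub_right (ν.2 i j hij) 1⟩, ?_⟩
      refine Subtype.ext (funext fun i => ?_)
      exact Nat.sub_add_cancel (h1 i)
    rw [Mwt, if_neg this]
    simp

end Summability

section Contours

open Metric

/-- The product of the `(1 - q u_l z) / (1 - u_l z)` over all `l`. -/
def poleProd (q : ℂ) {n : ℕ} (u : Fin n → ℂ) (z : ℂ) : ℂ :=
  ∏ l, (1 - q * u l * z) / (1 - u l * z)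

/-- The residue of `poleProd q u` at `(u j)⁻¹`. -/
def poleRes (q : ℂ) {n : ℕ} (u : Fin n → ℂ) (j : Fin n) : ℂ :=
  -(1 - q) * (u j)⁻¹ * ∏ l ∈ univ.erase j, qRatio q u j l

/-- Membership in the union of the closed disks of radius `δ` around the points `(u j)⁻¹`. -/
def NearPoles {n : ℕ} (u : Fin n → ℂ) (δ : ℝ) (z : ℂ) : Prop :=
  ∃ j, z ∈ closedBall (u j)⁻¹ δ

theorem circleIntegral_mul_poleProd (q : ℂ) {n : ℕ} {u : Fin n → ℂ} (h0 : ∀ i, u i ≠ 0) {δ : ℝ}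
    (hδ : 0 < δ) (j : Fin n) (hpole : ∀ l, l ≠ j → ∀ z ∈ closedBall (u j)⁻¹ δ, 1 - u l * z ≠ 0)
    (h : ℂ → ℂ) (hh : ∀ z ∈ closedBall (u j)⁻¹ δ, DifferentiableAt ℂ h z) :
    ∮ z in C((u j)⁻¹, δ), h z * poleProd q u z =
      2 * Real.pi * Complex.I * (h (u j)⁻¹ * poleRes q u j) := by
  let f : ℂ → ℂ := fun z => h z * (-(u j)⁻¹ * (1 - q * u j * z) *
    ∏ l ∈ univ.erase j, (1 - q * u l * z) / (1 - u l * z))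
  have hf : DifferentiableOn ℂ f (closedBall (u j)⁻¹ δ) := by
    intro z hz
    refine DifferentiableAt.differentiableWithinAt ?_
    refine (hh z hz).mul (DifferentiableAt.mul (by fun_prop) ?_)
    refine DifferentiableAt.fun_finsetProd fun l hl => ?_
    exact DifferentiableAt.div (by fun_prop) (by fun_prop) (hpole l (ne_of_mem_erase hl) z hz)
  have key := hf.circleIntegral_sub_inv_smul (mem_ball_self hδ)
  have e : (fun z => (z - (u j)⁻¹)⁻¹ • f z) = fun z => h z * poleProd q u z := by
    funext z
    have e1 : 1 - u j * z = -u j * (z - (u j)⁻¹) := by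
      have := h0 j
      field_simp
      ring
    rw [poleProd, ← mul_prod_erase univ _ (mem_univ j), e1, div_eq_mul_inv (1 - q * u j * z),
      mul_inv, inv_neg, smul_eq_mul]
    simp only [f]
    ring
  rw [e] at key
  rw [key, smul_eq_mul]
  simp only [f, poleRes]
  have e2 : ∀ l ∈ univ.erase j, (1 - q * u l * (u j)⁻¹) / (1 - u l * (u j)⁻¹) = qRatio q u j l := by
    intro l _
    have := h0 j
    rw [qRatio, ← mul_div_mul_right (1 - q * u l * (u j)⁻¹) _ this]
    congr 1 <;> field_simp
  rw [prod_congr rfl e2, mul_assoc q, mul_inv_cancel₀ (h0 j)]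
  ring

theorem iterInt_mul_poleProd (q : ℂ) {n : ℕ} {u : Fin n → ℂ} (h0 : ∀ i, u i ≠ 0) {δ : ℝ}
    (hδ : 0 < δ)
    (hpole : ∀ j l, l ≠ j → ∀ z ∈ closedBall (u j)⁻¹ δ, 1 - u l * z ≠ 0) {k : ℕ}
    (F H : (Fin k → ℂ) → ℂ) (hH : ∀ w, (∀ i, NearPoles u δ (w i)) → DifferentiableAt ℂ H w)
    (hF : ∀ w, (∀ i, NearPoles u δ (w i)) → F w = H w * ∏ i, poleProd q u (w i)) :
    iterInt k (fun _ => fun g => ∑ j, ∮ z in C((u j)⁻¹, δ), g z) F =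
      (2 * Real.pi * Complex.I) ^ k *
        ∑ g : Fin k → Fin n, H (fun i => (u (g i))⁻¹) * ∏ i, poleRes q u (g i) := by
  induction k with
  | zero =>
    rw [iterInt, hF _ fun i => i.elim0, Fintype.sum_unique]
    simp only [univ_eq_empty, prod_empty, mul_one, pow_zero, one_mul]
    congr 1
    exact Subsingleton.elim _ _
  | succ k ih =>
    have hnear : ∀ z : ℂ, NearPoles u δ z → ∀ w : Fin k → ℂ, (∀ i, NearPoles u δ (w i)) →
        ∀ i, NearPoles u δ ((Fin.cons z w : Fin (k + 1) → ℂ) i) := by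
      intro z hz w hw i
      induction i using Fin.cases with
      | zero => simpa using hz
      | succ i => simpa using hw i
    let h : ℂ → ℂ := fun z => (2 * Real.pi * Complex.I) ^ k * ∑ g : Fin k → Fin n,
      H (Fin.cons z fun i => (u (g i))⁻¹) * ∏ i, poleRes q u (g i)
    have hcenter : ∀ g : Fin k → Fin n, ∀ i, NearPoles u δ (u (g i))⁻¹ := fun g i =>
      ⟨g i, mem_closedBall_self hδ.le⟩
    have hh : ∀ z, NearPoles u δ z → DifferentiableAt ℂ h z := by
      intro z hz
      refine DifferentiableAt.const_mul (DifferentiableAt.fun_sum fun g _ => ?_) _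
      refine DifferentiableAt.mul_const ?_ _
      refine DifferentiableAt.comp z (hH _ (hnear z hz _ (hcenter g))) ?_
      rw [differentiableAt_pi]
      intro i
      induction i using Fin.cases with
      | zero => simp
      | succ i => simp
    have hin : ∀ z, NearPoles u δ z →
        iterInt k (fun _ => fun g => ∑ j, ∮ z in C((u j)⁻¹, δ), g z)
          (fun w => F (Fin.cons z w)) = h z * poleProd q u z := by
      intro z hz
      rw [ih (fun w => F (Fin.cons z w)) (fun w => poleProd q u z * H (Fin.cons z w))]
      · simp only [h, mul_assoc, sum_mul, mul_sum]
        refine sum_congr rfl fun g _ => ?_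
        ring
      · intro w hw
        refine DifferentiableAt.const_mul ?_ _
        refine DifferentiableAt.comp w (hH _ (hnear z hz w hw)) ?_
        rw [differentiableAt_pi]
        intro i
        induction i using Fin.cases with
        | zero => simp
        | succ i => simp only [Fin.cons_succ]; fun_prop
      · intro w hw
        rw [hF _ (hnear z hz w hw), Fin.prod_univ_succ]
        simp only [Fin.cons_zero, Fin.cons_succ]
        ring
    have hj : ∀ j, ∮ z in C((u j)⁻¹, δ),
        iterInt k (fun _ => fun g => ∑ j, ∮ z in C((u j)⁻¹, δ), g z)
          (fun w => F (Fin.cons z w)) =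
        2 * Real.pi * Complex.I * (h (u j)⁻¹ * poleRes q u j) := by
      intro j
      rw [← circleIntegral_mul_poleProd q h0 hδ j (hpole j) h fun z hz => hh z ⟨j, hz⟩]
      exact circleIntegral.integral_congr hδ.le fun z hz =>
        hin z ⟨j, sphere_subset_closedBall hz⟩
    rw [iterInt, sum_congr rfl fun j _ => hj j, ← (Fin.consEquiv fun _ => Fin n).sum_comp,
      Fintype.sum_prod_type, mul_sum]
    refine sum_congr rfl fun j _ => ?_
    simp only [h, mul_sum, sum_mul]
    refine sum_congr rfl fun g _ => ?_
    have e : (fun i => (u ((Fin.consEquiv fun _ => Fin n) (j, g) i))⁻¹) =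
        (Fin.cons (u j)⁻¹ fun i => (u (g i))⁻¹ : Fin (k + 1) → ℂ) := by
      funext i
      induction i using Fin.cases with
      | zero => simp [Fin.consEquiv]
      | succ i => simp [Fin.consEquiv]
    rw [e, Fin.prod_univ_succ]
    simp only [Fin.consEquiv, Equiv.coe_fn_mk, Fin.cons_zero, Fin.cons_succ]
    ring

end Contours

section Integrand

open ShuffleAlg

theorem prod_offDiag_eq_prod_lt {k : ℕ} (f : Fin k → Fin k → ℂ) (σ : Equiv.Perm (Fin k)) :
    ∏ p ∈ (univ : Finset (Fin k)).offDiag, f p.1 p.2 =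
      ∏ p ∈ (univ : Finset (Fin k × Fin k)).filter (fun p => p.1 < p.2),
        f (σ p.1) (σ p.2) * f (σ p.2) (σ p.1) := by
  have h1 : ∏ p ∈ (univ : Finset (Fin k)).offDiag, f p.1 p.2 =
      ∏ p ∈ (univ : Finset (Fin k)).offDiag, f (σ p.1) (σ p.2) :=
    (prod_equiv (σ.prodCongr σ) (by simp) (by simp)).symm
  have h2 : (univ : Finset (Fin k)).offDiag =
      (univ : Finset (Fin k × Fin k)).filter (fun p => p.1 < p.2) ∪
        (univ : Finset (Fin k × Fin k)).filter (fun p => p.2 < p.1) := by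
    ext p
    simp [lt_or_lt_iff_ne]
  have h3 : Disjoint ((univ : Finset (Fin k × Fin k)).filter (fun p => p.1 < p.2))
      ((univ : Finset (Fin k × Fin k)).filter (fun p => p.2 < p.1)) := by
    rw [disjoint_filter]
    exact fun p _ h h' => lt_asymm h h'
  rw [h1, h2, prod_union h3, prod_mul_distrib]
  congr 1
  exact prod_equiv (Equiv.prodComm _ _) (by simp) (by simp)

theorem prod_offDiag_eq_prod_erase {ι : Type*} [DecidableEq ι] (S : Finset ι) (f : ι → ι → ℂ) :
    ∏ p ∈ S.offDiag, f p.1 p.2 = ∏ i ∈ S, ∏ j ∈ S.erase i, f i j := by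
  rw [prod_sigma']
  refine prod_bij' (fun p _ => ⟨p.1, p.2⟩) (fun p _ => (p.1, p.2)) ?_ ?_ ?_ ?_ ?_
  · simp +contextual [ne_comm]
  · simp +contextual [ne_comm]
  · simp
  · simp
  · simp

/-- The part of the integrand without the factors that are singular at the points `(u j)⁻¹`. -/
def crossKernel (q s : ℂ) {k : ℕ} (θ : Fin k → ℕ) (w : Fin k → ℂ) : ℂ :=
  (∏ p ∈ (univ : Finset (Fin k)).offDiag, (w p.1 - w p.2) / (w p.1 - q * w p.2)) *
    ((-s) ^ (∑ i, θ i) * Fc q s θ (fun i => (w i)⁻¹) / ∏ i, w i)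

/-- A formula for `crossKernel` without singularities on the diagonals. -/
def regKernel (q s : ℂ) {k : ℕ} (θ : Fin k → ℕ) (w : Fin k → ℂ) : ℂ :=
  (-s) ^ (∑ i, θ i) * cconst q s θ * (1 - q) ^ k / (∏ i, (1 - s * (w i)⁻¹)) / (∏ i, w i) *
    ∑ σ : Equiv.Perm (Fin k),
      (∏ p ∈ (univ : Finset (Fin k × Fin k)).filter (fun p => p.1 < p.2),
        (w (σ p.1) - w (σ p.2)) / (w (σ p.1) - q * w (σ p.2))) *
      ∏ i, (((w (σ i))⁻¹ - s) / (1 - s * (w (σ i))⁻¹)) ^ θ i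

theorem crossKernel_eq_regKernel (q s : ℂ) {k : ℕ} (θ : Fin k → ℕ) (w : Fin k → ℂ)
    (h0 : ∀ i, w i ≠ 0) (hq : ∀ i j, w i ≠ q * w j) :
    crossKernel q s θ w = regKernel q s θ w := by
  have h : ∀ σ : Equiv.Perm (Fin k),
      (∏ p ∈ (univ : Finset (Fin k)).offDiag, (w p.1 - w p.2) / (w p.1 - q * w p.2)) *
        (∏ p ∈ (univ : Finset (Fin k × Fin k)).filter (fun p => p.1 < p.2),
          ((w (σ p.1))⁻¹ - q * (w (σ p.2))⁻¹) / ((w (σ p.1))⁻¹ - (w (σ p.2))⁻¹)) =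
      ∏ p ∈ (univ : Finset (Fin k × Fin k)).filter (fun p => p.1 < p.2),
        (w (σ p.1) - w (σ p.2)) / (w (σ p.1) - q * w (σ p.2)) := by
    intro σ
    rw [prod_offDiag_eq_prod_lt (fun a b => (w a - w b) / (w a - q * w b)) σ, ← prod_mul_distrib]
    refine prod_congr rfl fun p _ => ?_
    have ha := h0 (σ p.1)
    have hb := h0 (σ p.2)
    have hab : w (σ p.1) - w (σ p.2) * q ≠ 0 := by
      rw [mul_comm]; exact sub_ne_zero.2 (hq _ _)
    have hba : w (σ p.2) - w (σ p.1) * q ≠ 0 := by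
      rw [mul_comm]; exact sub_ne_zero.2 (hq _ _)
    generalize w (σ p.1) = a at *
    generalize w (σ p.2) = b at *
    by_cases hne : a = b
    · simp [hne]
    · have h1 : b - a ≠ 0 := sub_ne_zero.2 (Ne.symm hne)
      have h2 : a⁻¹ - b⁻¹ = (b - a) / (a * b) := by field_simp
      have h3 : a⁻¹ - q * b⁻¹ = (b - q * a) / (a * b) := by field_simp
      rw [h2, h3]
      field_simp
  rw [crossKernel, regKernel, Fc, Ffun, mul_sum, mul_sum, mul_sum, mul_sum, sum_div, mul_sum]
  refine sum_congr rfl fun σ _ => ?_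
  rw [← h σ]
  ring

theorem differentiableAt_finset_prod {E ι : Type*} [NormedAddCommGroup E] [NormedSpace ℂ E]
    {t : Finset ι} {f : ι → E → ℂ} {w : E} (h : ∀ a ∈ t, DifferentiableAt ℂ (f a) w) :
    DifferentiableAt ℂ (fun w => ∏ a ∈ t, f a w) w := by
  classical
  exact (HasFDerivAt.finsetProd fun a ha => (h a ha).hasFDerivAt).differentiableAt

theorem differentiableAt_regKernel (q s : ℂ) {k : ℕ} (θ : Fin k → ℕ) (w : Fin k → ℂ)
    (h0 : ∀ i, w i ≠ 0) (hs : ∀ i, w i ≠ s) (hq : ∀ i j, w i ≠ q * w j) :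
    DifferentiableAt ℂ (regKernel q s θ) w := by
  have hw : ∀ i, DifferentiableAt ℂ (fun w : Fin k → ℂ => w i) w := fun i => by fun_prop
  have hi : ∀ i, DifferentiableAt ℂ (fun w : Fin k → ℂ => (w i)⁻¹) w := fun i =>
    (hw i).fun_inv (h0 i)
  have hs1 : ∀ i, 1 - s * (w i)⁻¹ ≠ 0 := by
    intro i h
    have := h0 i
    field_simp at h
    exact hs i (by linear_combination h)
  have hd : ∀ i, DifferentiableAt ℂ (fun w : Fin k → ℂ => 1 - s * (w i)⁻¹) w := fun i =>
    ((hi i).const_mul s).const_sub 1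
  unfold regKernel
  have hdiv : ∀ {f g : (Fin k → ℂ) → ℂ}, DifferentiableAt ℂ f w → DifferentiableAt ℂ g w →
      g w ≠ 0 → DifferentiableAt ℂ (fun w => f w / g w) w := fun hf hg h => by
    simp only [div_eq_mul_inv]
    exact hf.fun_mul (hg.fun_inv h)
  refine DifferentiableAt.fun_mul (hdiv (hdiv
    (differentiableAt_const _) ?_ ?_) ?_ ?_)
    (DifferentiableAt.fun_sum fun σ _ => DifferentiableAt.fun_mul ?_ ?_)
  · exact differentiableAt_finset_prod fun i _ => hd i
  · exact prod_ne_zero_iff.2 fun i _ => hs1 i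
  · exact differentiableAt_finset_prod fun i _ => hw i
  · exact prod_ne_zero_iff.2 fun i _ => h0 i
  · refine differentiableAt_finset_prod fun p _ => ?_
    exact hdiv ((hw _).sub (hw _)) ((hw _).sub ((hw _).const_mul q)) (sub_ne_zero.2 (hq _ _))
  · refine differentiableAt_finset_prod fun i _ => ?_
    exact (hdiv ((hi _).sub_const s) (hd _) (hs1 _)).fun_pow _

end Integrand

section ResidueSum

open ShuffleAlg

theorem prod_offDiag_mul_prod_poleRes {q : ℂ} {n k : ℕ} {u : Fin n → ℂ} (h0 : ∀ i, u i ≠ 0)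
    (hu : Function.Injective u) (huq : ∀ i j, u i ≠ q * u j) {g : Fin k → Fin n}
    (hg : Function.Injective g) :
    (∏ p ∈ (univ : Finset (Fin k)).offDiag,
        ((u (g p.1))⁻¹ - (u (g p.2))⁻¹) / ((u (g p.1))⁻¹ - q * (u (g p.2))⁻¹)) *
      ∏ i, poleRes q u (g i) =
    (-(1 - q)) ^ k * (∏ i, (u (g i))⁻¹) *
      cross (qRatio q u) (univ.image g) (univ \ univ.image g) := by
  have hc : ∀ i j, i ≠ j → qRatio q u i j ≠ 0 := fun i j hij =>
    div_ne_zero (sub_ne_zero.2 (huq i j)) (sub_ne_zero.2 fun h => hij (hu h))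
  have h1 : ∏ p ∈ (univ : Finset (Fin k)).offDiag,
      ((u (g p.1))⁻¹ - (u (g p.2))⁻¹) / ((u (g p.1))⁻¹ - q * (u (g p.2))⁻¹) =
      (∏ p ∈ (univ : Finset (Fin k)).offDiag, qRatio q u (g p.1) (g p.2))⁻¹ := by
    rw [← prod_inv_distrib]
    refine prod_equiv (Equiv.prodComm _ _) (by simp [ne_comm]) fun p _ => ?_
    simp only [Equiv.prodComm_apply, Prod.fst_swap, Prod.snd_swap, qRatio, inv_div]
    have ha := h0 (g p.1)
    have hb := h0 (g p.2)
    have hab : u (g p.1) * u (g p.2) ≠ 0 := mul_ne_zero ha hb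
    rw [← mul_div_mul_right (_ - _) _ hab]
    congr 1 <;> field_simp
  have h2 : ∏ p ∈ (univ : Finset (Fin k)).offDiag, qRatio q u (g p.1) (g p.2) =
      ∏ i ∈ univ.image g, ∏ l ∈ (univ.image g).erase i, qRatio q u i l := by
    rw [prod_offDiag_eq_prod_erase univ (fun a b => qRatio q u (g a) (g b)),
      prod_image fun a _ b _ h => hg h]
    refine prod_congr rfl fun i _ => ?_
    rw [← image_erase hg, prod_image fun a _ b _ h => hg h]
  have h3 : ∏ i, poleRes q u (g i) = (-(1 - q)) ^ k * (∏ i, (u (g i))⁻¹) *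
      ((∏ i ∈ univ.image g, ∏ l ∈ (univ.image g).erase i, qRatio q u i l) *
        cross (qRatio q u) (univ.image g) (univ \ univ.image g)) := by
    simp only [poleRes, prod_mul_distrib, prod_const, card_univ, Fintype.card_fin]
    congr 1
    rw [cross, ← prod_mul_distrib, prod_image fun a _ b _ h => hg h]
    refine prod_congr rfl fun i _ => ?_
    have hi : g i ∈ univ.image g := mem_image_of_mem g (mem_univ i)
    rw [← prod_union]
    · refine prod_congr ?_ fun _ _ => rfl
      ext l
      by_cases hl : l ∈ univ.image g
      · simp [hl]
      · have : l ≠ g i := fun h => hl (h ▸ hi)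
        simp [hl, this]
    · exact disjoint_sdiff.mono_left (erase_subset _ _)
  have hne : ∏ i ∈ univ.image g, ∏ l ∈ (univ.image g).erase i, qRatio q u i l ≠ 0 :=
    prod_ne_zero_iff.2 fun i _ => prod_ne_zero_iff.2 fun l hl => hc i l (ne_of_mem_erase hl).symm
  rw [h1, h2, h3]
  field_simp

theorem levelWord_eq_zero {ι : Type*} [DecidableEq ι] (c : ι → ι → ℂ) (x : ι → ℂ) (m : ℕ → ℕ)
    (L : ℕ) (S : Finset ι) (h : #S ≠ ∑ j ∈ range L, m j) : levelWord c x m L S = 0 := by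
  induction L generalizing S with
  | zero =>
    rw [levelWord, one_apply, if_neg]
    simpa using h
  | succ L ih =>
    rw [levelWord, mul_apply]
    refine sum_eq_zero fun B hB => ?_
    have hc := card_sdiff_add_card_eq_card (mem_powerset.1 hB)
    rw [tw_apply, ofCard_apply]
    split_ifs with hBm
    · rw [ih]
      · simp
      · rw [sum_range_succ] at h
        omega
    · simp

theorem sum_injective_image {n : ℕ} (k : ℕ) (φ : Finset (Fin n) → ℂ) :
    ∑ g : Fin k → Fin n, (if Function.Injective g then φ (univ.image g) else 0) =
      k.factorial * ∑ I ∈ powersetCard k univ, φ I := by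
  have hm : ∀ g ∈ (univ : Finset (Fin k → Fin n)).filter Function.Injective,
      univ.image g ∈ powersetCard k (univ : Finset (Fin n)) := by
    intro g hg
    rw [mem_filter] at hg
    refine mem_powersetCard.2 ⟨subset_univ _, ?_⟩
    rw [card_image_of_injective _ hg.2, card_univ, Fintype.card_fin]
  rw [← sum_filter, ← sum_fiberwise_of_maps_to hm, mul_sum]
  refine sum_congr rfl fun I hI => ?_
  rw [sum_congr rfl fun g hg => by rw [(mem_filter.1 hg).2], sum_const, nsmul_eq_mul]
  congr 2
  have hk : #I = k := (mem_powersetCard.1 hI).2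
  rw [filter_filter]
  have := sum_perm_comp_injective (I.orderEmbOfFin hk).injective (fun _ => (1 : ℕ))
  have him : univ.image (I.orderEmbOfFin hk) = I := by
    ext a
    simp
  rw [him] at this
  simpa [Fintype.card_perm] using this.symm

theorem sum_residues {q : ℂ} (hq : ∀ m : ℕ, q ^ (m + 1) ≠ 1) (s : ℂ) {n k L : ℕ} {u : Fin n → ℂ}
    (hu : Function.Injective u) (h0 : ∀ i, u i ≠ 0) (h1 : ∀ i, 1 - s * u i ≠ 0)
    (huq : ∀ i j, u i ≠ q * u j) (θ : Fin k → ℕ)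
    (hθ : ∀ i j, i ≤ j → θ j ≤ θ i) (hL : ∀ i, θ i < L) :
    ∑ g : Fin k → Fin n, crossKernel q s θ (fun i => (u (g i))⁻¹) * ∏ i, poleRes q u (g i) =
      (-(1 - q)) ^ k * k.factorial * ((∏ i, (1 - s * u i))⁻¹ *
        (markedProd q (s ^ 2) u (fun i => -s * ((u i - s) / (1 - s * u i))) (mult θ) L *
          affProd q u (-s) 1 : ShuffleAlg (qRatio q u)) univ) := by
  let φ : Finset (Fin n) → ℂ := fun I => (-(1 - q)) ^ k * ((∏ i ∈ I, (1 - s * u i))⁻¹ *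
    markedProd q (s ^ 2) u (fun i => -s * ((u i - s) / (1 - s * u i))) (mult θ) L I *
      cross (qRatio q u) I (univ \ I))
  have hg : ∀ g : Fin k → Fin n,
      crossKernel q s θ (fun i => (u (g i))⁻¹) * ∏ i, poleRes q u (g i) =
        if Function.Injective g then φ (univ.image g) else 0 := by
    intro g
    split_ifs with hg
    · have hres := prod_offDiag_mul_prod_poleRes h0 hu huq hg
      have hF := neg_pow_mul_Fc hq s hu h0 θ hθ hL hg
      have hprod : (∏ i, (u (g i))⁻¹) ≠ 0 := prod_ne_zero_iff.2 fun i _ => inv_ne_zero (h0 _)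
      rw [crossKernel]
      simp only [inv_inv]
      rw [hF, mul_right_comm, hres]
      simp only [φ]
      rw [prod_image fun a _ b _ h => hg h]
      generalize (∏ i, (u (g i))⁻¹) = P at *
      field_simp
    · rw [Function.Injective] at hg
      push Not at hg
      obtain ⟨a, b, hab, hne⟩ := hg
      rw [crossKernel, prod_eq_zero (i := (a, b))]
      · simp
      · simp [hne]
      · simp [hab]
  rw [sum_congr rfl fun g _ => hg g, sum_injective_image, mul_apply, mul_sum, mul_sum, mul_sum,
    ← sum_subset (s₁ := powersetCard k univ)
      fun I hI => mem_powerset.2 (mem_powersetCard.1 hI).1]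
  · refine sum_congr rfl fun I _ => ?_
    have hE : (affProd q u (-s) 1 : ShuffleAlg (qRatio q u)) (univ \ I) =
        ∏ i ∈ univ \ I, (1 - s * u i) := prod_congr rfl fun i _ => by ring
    have h2 : ∏ i ∈ univ \ I, (1 - s * u i) ≠ 0 := prod_ne_zero_iff.2 fun i _ => h1 i
    have h3 : ∏ i ∈ I, (1 - s * u i) ≠ 0 := prod_ne_zero_iff.2 fun i _ => h1 i
    rw [hE, ← prod_sdiff (subset_univ I)]
    simp only [φ]
    field_simp
  · intro I hI hIk
    rw [markedProd_eq, ShuffleAlg.smul_apply, levelWord_eq_zero]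
    · simp
    · rw [sum_mult θ hL]
      simpa [mem_powersetCard] using hIk

end ResidueSum

section SmallCircles

open Filter Topology Metric

theorem eventually_forall_mem_closedBall {X : Type*} [PseudoMetricSpace X] {a : X} {P : X → Prop}
    (h : ∀ᶠ z in 𝓝 a, P z) : ∀ᶠ δ : ℝ in 𝓝[>] 0, ∀ z ∈ closedBall a δ, P z := by
  obtain ⟨ε, hε, hP⟩ := Metric.eventually_nhds_iff_ball.1 h
  filter_upwards [Ioo_mem_nhdsGT hε] with δ hδ z hz
  exact hP z (closedBall_subset_ball hδ.2 hz)

theorem eventually_circles_avoid {q s : ℂ} {n : ℕ} {u : Fin n → ℂ} (hu : Function.Injective u)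
    (h0 : ∀ i, u i ≠ 0) (h1 : ∀ i, 1 - s * u i ≠ 0) (huq : ∀ i j, u i ≠ q * u j) :
    ∀ᶠ δ : ℝ in 𝓝[>] 0,
      (∀ j l, l ≠ j → ∀ z ∈ closedBall (u j)⁻¹ δ, 1 - u l * z ≠ 0) ∧
      (∀ z, NearPoles u δ z → z ≠ 0) ∧ (∀ z, NearPoles u δ z → z ≠ s) ∧
      ∀ z w, NearPoles u δ z → NearPoles u δ w → z ≠ q * w := by
  have hpole : ∀ᶠ δ : ℝ in 𝓝[>] 0, ∀ j l, l ≠ j → ∀ z ∈ closedBall (u j)⁻¹ δ,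
      1 - u l * z ≠ 0 := by
    refine eventually_all.2 fun j => eventually_all.2 fun l => ?_
    by_cases hl : l = j
    · simp [hl]
    have : ∀ᶠ z in 𝓝 (u j)⁻¹, 1 - u l * z ≠ 0 := by
      refine ContinuousAt.eventually_ne (by fun_prop) fun h => hl (hu ?_)
      have := h0 j
      field_simp at h
      linear_combination -h
    filter_upwards [eventually_forall_mem_closedBall this] with δ h _ using h
  have hzero : ∀ᶠ δ : ℝ in 𝓝[>] 0, ∀ j, ∀ z ∈ closedBall (u j)⁻¹ δ, z ≠ 0 :=
    eventually_all.2 fun j => eventually_forall_mem_closedBall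
      (continuousAt_id.eventually_ne (inv_ne_zero (h0 j)))
  have hs : ∀ᶠ δ : ℝ in 𝓝[>] 0, ∀ j, ∀ z ∈ closedBall (u j)⁻¹ δ, z ≠ s := by
    refine eventually_all.2 fun j => eventually_forall_mem_closedBall
      (continuousAt_id.eventually_ne fun h => h1 j ?_)
    have h' : (u j)⁻¹ = s := h
    rw [← h', inv_mul_cancel₀ (h0 j), sub_self]
  have hcross : ∀ᶠ δ : ℝ in 𝓝[>] 0, ∀ i j,
      ∀ p ∈ closedBall ((u i)⁻¹, (u j)⁻¹) δ, p.1 - q * p.2 ≠ 0 := by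
    refine eventually_all.2 fun i => eventually_all.2 fun j => eventually_forall_mem_closedBall
      (ContinuousAt.eventually_ne (by fun_prop) fun h => huq j i ?_)
    have := h0 i
    have := h0 j
    simp only at h
    field_simp at h
    linear_combination h
  filter_upwards [hpole, hzero, hs, hcross] with δ a b c d
  refine ⟨a, fun z ⟨j, hz⟩ => b j z hz, fun z ⟨j, hz⟩ => c j z hz, ?_⟩
  rintro z w ⟨i, hz⟩ ⟨j, hw⟩ h
  refine d i j (z, w) ?_ (sub_eq_zero.2 h)
  rw [← closedBall_prod_same]
  exact ⟨hz, hw⟩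

theorem norm_neg_mul_div_lt_one {s u : ℝ} (hs : s ∈ Set.Ioo (-1 : ℝ) 0) (hu : 0 < u) :
    ‖-(s : ℂ) * (((u : ℂ) - s) / (1 - s * u))‖ < 1 := by
  have hpos : 0 < 1 - s * u := by nlinarith [hs.2, mul_pos (neg_pos.2 hs.2) hu]
  have h : -(s : ℂ) * (((u : ℂ) - s) / (1 - s * u)) = ((-s * ((u - s) / (1 - s * u)) : ℝ) : ℂ) := by
    push_cast
    rfl
  have hle : 0 ≤ -s * ((u - s) / (1 - s * u)) :=
    mul_nonneg (by linarith [hs.2]) (div_nonneg (by linarith [hs.2]) hpos.le)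
  rw [h, Complex.norm_real, Real.norm_of_nonneg hle, ← mul_div_assoc, div_lt_one hpos]
  nlinarith [hs.1, hs.2]

end SmallCircles

/-- Theorem 8.13 (case 2): the nested contour integral formula for the q-correlation functions
of the stochastic higher spin six vertex model started from the empty configuration, with
`γ[ū]` realized as small circles around the points `u_j⁻¹`. -/
theorem q_correlation_functions (q s : ℝ) (hq : q ∈ Set.Ioo (0 : ℝ) 1)
    (hs : s ∈ Set.Ioo (-1 : ℝ) 0) (n : ℕ) (hn : 1 ≤ n) (u : Fin n → ℝ)
    (hupos : ∀ i, 0 < u i) (huinj : Function.Injective u)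
    (huq : ∀ i j, u i ≠ q * u j) (k : ℕ) (hk1 : 1 ≤ k) (hkn : k ≤ n) (θ : Sign k) :
    ∃ δ₀ : ℝ, 0 < δ₀ ∧ ∀ δ ∈ Set.Ioo (0 : ℝ) δ₀,
      Summable (fun ν : Sign n =>
        Mwt (q : ℂ) (s : ℂ) (fun i => (u i : ℂ)) ν.1 * Qobs (q : ℂ) (fun i => θ.1 i + 1) ν.1) ∧
      ∑' ν : Sign n,
          Mwt (q : ℂ) (s : ℂ) (fun i => (u i : ℂ)) ν.1 * Qobs (q : ℂ) (fun i => θ.1 i + 1) ν.1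
        = (-1) ^ k * (q : ℂ) ^ (k * (k + 1) / 2) /
            ((1 - (q : ℂ)) ^ k * (Nat.factorial k : ℂ)) *
            (1 / (2 * (Real.pi : ℂ) * Complex.I)) ^ k *
            iterInt k (fun _ => fun g => ∑ j, ∮ z in C(((u j : ℂ))⁻¹, δ), g z)
              (fun w =>
                (∏ p ∈ (Finset.univ : Finset (Fin k)).offDiag,
                  (w p.1 - w p.2) / (w p.1 - (q : ℂ) * w p.2)) *
                ((-(s : ℂ)) ^ (∑ i, θ.1 i) *
                  Fc (q : ℂ) (s : ℂ) θ.1 (fun i => (w i)⁻¹) / ∏ i, w i) *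
                ∏ i, ∏ j, (1 - (q : ℂ) * (u j : ℂ) * w i) / (1 - (u j : ℂ) * w i)) := by
  have hq1 : ∀ m : ℕ, (q : ℂ) ^ (m + 1) ≠ 1 := by
    intro m
    exact_mod_cast (pow_lt_one₀ hq.1.le hq.2 m.succ_ne_zero).ne
  have hqn : ‖(q : ℂ)‖ < 1 := by
    rw [Complex.norm_real, Real.norm_of_nonneg hq.1.le]
    exact hq.2
  have hu : Function.Injective fun i => (u i : ℂ) := Complex.ofReal_injective.comp huinj
  have h0 : ∀ i, (u i : ℂ) ≠ 0 := fun i => by exact_mod_cast (hupos i).ne'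
  have h1 : ∀ i, 1 - (s : ℂ) * (u i : ℂ) ≠ 0 := by
    intro i
    have : 1 - s * u i ≠ 0 := by nlinarith [mul_pos (neg_pos.2 hs.2) (hupos i)]
    exact_mod_cast this
  have huqc : ∀ i j, (u i : ℂ) ≠ (q : ℂ) * (u j : ℂ) := fun i j => by exact_mod_cast huq i j
  have hx1 := fun i => norm_neg_mul_div_lt_one hs (hupos i)
  have hL : ∀ i, θ.1 i < univ.sup θ.1 + 1 := fun i => Nat.lt_succ_of_le (le_sup (mem_univ i))
  have hsum := hasSum_Mwt_mul_Qobs (hasSum_weight hq1 hqn s hu h0 h1 hx1 θ.1 θ.2 hL)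
  obtain ⟨δ₀, hδ₀, hδ⟩ :=
    mem_nhdsGT_iff_exists_Ioo_subset.1 (eventually_circles_avoid hu h0 h1 huqc)
  refine ⟨δ₀, hδ₀, fun δ hmem => ⟨hsum.summable, ?_⟩⟩
  obtain ⟨hpole, hz, hzs, hzq⟩ := hδ hmem
  rw [hsum.tsum_eq, iterInt_mul_poleProd (q : ℂ) h0 hmem.1 hpole _ (regKernel (q : ℂ) s θ.1)
    (fun w hw => differentiableAt_regKernel _ _ _ _ (fun i => hz _ (hw i)) (fun i => hzs _ (hw i))
      fun i j => hzq _ _ (hw i) (hw j))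
    fun w hw => by
      rw [← crossKernel_eq_regKernel _ _ _ _ (fun i => hz _ (hw i))
        fun i j => hzq _ _ (hw i) (hw j)]
      rfl]
  have hreg : ∀ g : Fin k → Fin n, regKernel (q : ℂ) s θ.1 (fun i => ((u (g i) : ℂ))⁻¹) =
      crossKernel (q : ℂ) s θ.1 fun i => ((u (g i) : ℂ))⁻¹ := by
    intro g
    have hnear : ∀ i, NearPoles (fun i => (u i : ℂ)) δ ((u (g i) : ℂ))⁻¹ := fun i =>
      ⟨g i, Metric.mem_closedBall_self hmem.1.le⟩
    exact (crossKernel_eq_regKernel _ _ _ _ (fun i => hz _ (hnear i))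
      fun i j => hzq _ _ (hnear i) (hnear j)).symm
  simp only [hreg]
  rw [sum_residues hq1 s hu h0 h1 huqc θ.1 θ.2 hL]
  have hq' : (1 - (q : ℂ)) ^ k ≠ 0 := pow_ne_zero _ (sub_ne_zero.2 (by simpa using (hq1 0).symm))
  have hk : (k.factorial : ℂ) ≠ 0 := by exact_mod_cast k.factorial_ne_zero
  have hpi : (2 * (Real.pi : ℂ) * Complex.I) ^ k ≠ 0 := pow_ne_zero _ Complex.two_pi_I_ne_zero
  have hsign : ((-1 : ℂ) ^ k) * (-1) ^ k = 1 := by rw [← mul_pow]; simp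
  rw [neg_pow (1 - (q : ℂ)) k, one_div, inv_pow]
  generalize (ShuffleAlg.markedProd _ _ _ _ _ _ * ShuffleAlg.affProd _ _ _ _ :
    ShuffleAlg (ι := Fin n) _) univ = M
  generalize (∏ i, (1 - (s : ℂ) * (u i : ℂ)))⁻¹ = W
  field_simp
  linear_combination (-(q : ℂ) ^ (k * (k + 1) / 2) * W * M) * hsign

end
end
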